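/- Let (G,w) be a simple weighted graph and let G' be its associated simple graph. Then cr(G,w) = cr(G'). -/

import Mathlib

open Set

noncomputable section

abbrev Plane : Type := ℝ × ℝ

/-- The setoid on nonzero vectors of `ℝ³` identifying nonzero scalar multiples. -/
def projSetoid : Setoid {v : Fin 3 → ℝ // v ≠ 0} where
  r v w := ∃ c : ℝ, c ≠ 0 ∧ c • v.1 = w.1
  iseqv := by
    constructor
    · exact fun v => ⟨1, one_ne_zero, one_smul _ _⟩
    · rintro v w ⟨c, hc, h⟩
      exact ⟨c⁻¹, inv_ne_zero hc, by rw [← h, smul_smul, inv_mul_cancel₀ hc, one_smul]⟩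
    · rintro u v w ⟨c, hc, h⟩ ⟨d, hd, h'⟩
      exact ⟨d * c, mul_ne_zero hd hc, by rw [← h', ← h, smul_smul]⟩

/-- The real projective plane, as the quotient of `ℝ³ \ {0}` by nonzero scaling. -/
def RP2 : Type := Quotient projSetoid

instance : TopologicalSpace RP2 := instTopologicalSpaceQuotient

/-- The standard affine embedding of the plane in the projective plane. -/
def planeToRP2 (p : Plane) : RP2 :=
  Quotient.mk projSetoid ⟨![p.1, p.2, 1], by
    intro h
    simpa using congrFun h 2⟩

/-- A pseudoline: a simple closed curve in the projective plane that does not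
disconnect it. -/
def IsPseudoline (L : Set RP2) : Prop :=
  ∃ f : AddCircle (1 : ℝ) → RP2,
    Continuous f ∧ Function.Injective f ∧ Set.range f = L ∧ IsConnected Lᶜ

/-- A drawing of a graph in the plane: vertices are distinct points, each edge is a
simple arc (parametrized on `[0,1]`) joining its endpoints, and no arc passes
through a vertex other than its endpoints. -/
structure Drawing {V : Type*} (G : SimpleGraph V) where
  vert : V → Plane
  vert_inj : Function.Injective vert
  arc : G.edgeSet → ℝ → Plane
  arc_cont : ∀ e, ContinuousOn (arc e) (Icc 0 1)
  arc_injOn : ∀ e, InjOn (arc e) (Icc 0 1)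
  arc_ends : ∀ e : G.edgeSet, ∃ x y : V,
    (e : Sym2 V) = s(x, y) ∧ arc e 0 = vert x ∧ arc e 1 = vert y
  arc_avoid : ∀ (e : G.edgeSet) (t : ℝ), t ∈ Icc (0:ℝ) 1 →
    (∃ v, arc e t = vert v) → t = 0 ∨ t = 1

namespace Drawing

variable {V : Type*} {G : SimpleGraph V} (D : Drawing G)

/-- The interior (relative to its endpoints) of the arc of an edge. -/
def interOf (e : G.edgeSet) : Set Plane := D.arc e '' Ioo 0 1

/-- The set of crossings of a drawing: pairs consisting of a point of the plane
together with an (unordered) pair of distinct edges whose interiors both pass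
through the point. -/
def CrossSet : Set (Plane × Sym2 G.edgeSet) :=
  { x | ∃ e f : G.edgeSet, e ≠ f ∧ x.2 = s(e, f) ∧
      x.1 ∈ D.interOf e ∧ x.1 ∈ D.interOf f }

/-- The weighted number of crossings of a drawing: each crossing of a pair of
edges `e`, `f` contributes `w e * w f`. -/
def wcount (w : Sym2 V → ℕ) : ℕ :=
  ∑ᶠ x ∈ D.CrossSet,
    Sym2.lift ⟨fun e f : G.edgeSet => w e * w f, fun e f => mul_comm _ _⟩ x.2

/-- A drawing is pseudolinear if each edge can be extended to a pseudoline of the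
projective plane (via the standard affine embedding of the plane in the projective
plane) so that the extensions form a pseudoline arrangement: any two of the
pseudolines extending distinct edges meet in exactly one point. -/
def IsPseudolinear : Prop :=
  ∃ L : G.edgeSet → Set RP2,
    (∀ e, IsPseudoline (L e)) ∧
    (∀ e, ∀ t ∈ Icc (0:ℝ) 1, planeToRP2 (D.arc e t) ∈ L e) ∧
    (∀ e f, e ≠ f → ∃! p, p ∈ L e ∧ p ∈ L f)

/-- A drawing is rectilinear if every edge is drawn as a straight line segment. -/
def IsRectilinear : Prop :=
  ∀ e, ∀ t ∈ Icc (0:ℝ) 1, D.arc e t = (1 - t) • D.arc e 0 + t • D.arc e 1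

/-- A drawing is x-monotone if every edge meets every vertical line in at most one
point. -/
def IsMonotone : Prop :=
  ∀ e, InjOn (fun t => (D.arc e t).1) (Icc 0 1)

end Drawing

/-- The crossing number of `G` relative to a class of drawings `P`: the minimum
number of crossings in a drawing of `G` satisfying `P` (with finitely many
crossings). -/
def crNumP {V : Type*} (G : SimpleGraph V) (P : Drawing G → Prop) : ℕ :=
  sInf { n | ∃ D : Drawing G, P D ∧ D.CrossSet.Finite ∧ D.CrossSet.ncard = n }

/-- The crossing number `cr G`. -/
def crNum {V : Type*} (G : SimpleGraph V) : ℕ := crNumP G fun _ => True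

/-- The pseudolinear crossing number `pcr G`. -/
def pcrNum {V : Type*} (G : SimpleGraph V) : ℕ := crNumP G Drawing.IsPseudolinear

/-- The rectilinear crossing number `rcr G`. -/
def rcrNum {V : Type*} (G : SimpleGraph V) : ℕ := crNumP G Drawing.IsRectilinear

/-- The monotone crossing number `mon-cr G`. -/
def moncrNum {V : Type*} (G : SimpleGraph V) : ℕ := crNumP G Drawing.IsMonotone

/-- The weighted crossing number of `(G, w)` relative to a class of drawings. -/
def wcrNumP {V : Type*} (G : SimpleGraph V) (w : Sym2 V → ℕ) (P : Drawing G → Prop) : ℕ :=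
  sInf { n | ∃ D : Drawing G, P D ∧ D.CrossSet.Finite ∧ D.wcount w = n }

/-- The weighted crossing number `cr (G, w)`. -/
def wcrNum {V : Type*} (G : SimpleGraph V) (w : Sym2 V → ℕ) : ℕ :=
  wcrNumP G w fun _ => True

/-- The weighted pseudolinear crossing number `pcr (G, w)`. -/
def wpcrNum {V : Type*} (G : SimpleGraph V) (w : Sym2 V → ℕ) : ℕ :=
  wcrNumP G w Drawing.IsPseudolinear

/-- The weighted rectilinear crossing number `rcr (G, w)`. -/
def wrcrNum {V : Type*} (G : SimpleGraph V) (w : Sym2 V → ℕ) : ℕ :=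
  wcrNumP G w Drawing.IsRectilinear

/-- The simple graph associated to a weighted graph `(G, w)`: each edge `e` of `G`
is replaced by a collection of `w e` internally disjoint 2-paths with the same
endpoints as `e` (the midpoint of the `i`-th such 2-path being the new vertex
`⟨e, i⟩`). -/
def assocGraph {V : Type*} (G : SimpleGraph V) (w : Sym2 V → ℕ) :
    SimpleGraph (V ⊕ Σ e : G.edgeSet, Fin (w e)) :=
  SimpleGraph.fromRel fun x y =>
    ∃ (e : G.edgeSet) (i : Fin (w e)) (v : V),
      x = Sum.inl v ∧ y = Sum.inr ⟨e, i⟩ ∧ v ∈ (e : Sym2 V)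

section PlaneGeometry

open Filter Topology

/-- The oriented area spanned by two plane vectors. -/
def wedge (u v : Plane) : ℝ := u.1 * v.2 - u.2 * v.1

/-- The Euclidean inner product of two plane vectors. -/
def dotp (u v : Plane) : ℝ := u.1 * v.1 + u.2 * v.2

/-- The square of the Euclidean distance of two points of the plane. -/
def sqDist (p z : Plane) : ℝ := (z.1 - p.1) ^ 2 + (z.2 - p.2) ^ 2

@[fun_prop]
lemma continuous_wedge {X : Type*} [TopologicalSpace X] {f g : X → Plane} (hf : Continuous f)
    (hg : Continuous g) : Continuous fun x => wedge (f x) (g x) := by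
  unfold wedge; fun_prop

@[fun_prop]
lemma continuous_dotp {X : Type*} [TopologicalSpace X] {f g : X → Plane} (hf : Continuous f)
    (hg : Continuous g) : Continuous fun x => dotp (f x) (g x) := by
  unfold dotp; fun_prop

@[fun_prop]
lemma continuous_sqDist {X : Type*} [TopologicalSpace X] {f g : X → Plane} (hf : Continuous f)
    (hg : Continuous g) : Continuous fun x => sqDist (f x) (g x) := by
  unfold sqDist; fun_prop

lemma sqDist_self (p : Plane) : sqDist p p = 0 := by simp [sqDist]

lemma sqDist_nonneg (p z : Plane) : 0 ≤ sqDist p z := by unfold sqDist; positivity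

lemma sqDist_pos {p z : Plane} (h : p ≠ z) : 0 < sqDist p z := by
  refine (sqDist_nonneg p z).lt_of_ne fun h0 => h ?_
  unfold sqDist at h0
  ext <;> nlinarith [sq_nonneg (z.1 - p.1), sq_nonneg (z.2 - p.2)]

lemma sqDist_triangle (p q z : Plane) : sqDist p q ≤ 2 * (sqDist p z + sqDist q z) := by
  unfold sqDist
  nlinarith [sq_nonneg (z.1 - p.1 + (z.1 - q.1)), sq_nonneg (z.2 - p.2 + (z.2 - q.2))]

lemma mem_segment_iff {a b z : Plane} :
    z ∈ segment ℝ a b ↔ ∃ t : ℝ, 0 ≤ t ∧ t ≤ 1 ∧ z = a + t • (b - a) := by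
  rw [segment_eq_image']
  constructor
  · rintro ⟨t, ⟨h0, h1⟩, rfl⟩; exact ⟨t, h0, h1, rfl⟩
  · rintro ⟨t, h0, h1, rfl⟩; exact ⟨t, ⟨h0, h1⟩, rfl⟩

lemma isCompact_segment (a b : Plane) : IsCompact (segment ℝ a b) := by
  rw [segment_eq_image']
  exact isCompact_Icc.image (by fun_prop)

lemma eq_of_mem_segments_of_wedge_ne {a b c d z z' : Plane} (h : wedge (b - a) (d - c) ≠ 0)
    (h1 : z ∈ segment ℝ a b) (h2 : z ∈ segment ℝ c d)
    (h3 : z' ∈ segment ℝ a b) (h4 : z' ∈ segment ℝ c d) : z = z' := by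
  obtain ⟨t, -, -, rfl⟩ := mem_segment_iff.1 h1
  obtain ⟨s, -, -, e⟩ := mem_segment_iff.1 h2
  obtain ⟨t', -, -, rfl⟩ := mem_segment_iff.1 h3
  obtain ⟨s', -, -, e'⟩ := mem_segment_iff.1 h4
  have e1 := congrArg Prod.fst e
  have e2 := congrArg Prod.snd e
  have e1' := congrArg Prod.fst e'
  have e2' := congrArg Prod.snd e'
  simp only [Prod.fst_add, Prod.snd_add, Prod.smul_fst, Prod.smul_snd, smul_eq_mul, Prod.fst_sub,
    Prod.snd_sub, wedge] at *
  have : (t - t') * ((b.1 - a.1) * (d.2 - c.2) - (b.2 - a.2) * (d.1 - c.1)) = 0 := by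
    linear_combination (d.2 - c.2) * (e1 - e1') - (d.1 - c.1) * (e2 - e2')
  rcases mul_eq_zero.1 this with h' | h'
  · rw [sub_eq_zero.1 h']
  · exact absurd h' h

lemma eq_start_of_mem_segments {a b c z : Plane}
    (h : wedge (b - a) (c - a) ≠ 0 ∨ dotp (b - a) (c - a) < 0)
    (h1 : z ∈ segment ℝ a b) (h2 : z ∈ segment ℝ a c) : z = a := by
  rcases h with h | h
  · exact eq_of_mem_segments_of_wedge_ne h h1 h2 (left_mem_segment ..) (left_mem_segment ..)
  · obtain ⟨t, t0, -, rfl⟩ := mem_segment_iff.1 h1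
    obtain ⟨s, s0, -, e⟩ := mem_segment_iff.1 h2
    have e1 := congrArg Prod.fst e
    have e2 := congrArg Prod.snd e
    simp only [Prod.fst_add, Prod.snd_add, Prod.smul_fst, Prod.smul_snd, smul_eq_mul, Prod.fst_sub,
      Prod.snd_sub, dotp] at *
    set u1 := b.1 - a.1
    set u2 := b.2 - a.2
    set v1 := c.1 - a.1
    set v2 := c.2 - a.2
    have k1 : t * u1 = s * v1 := by linarith
    have k2 : t * u2 = s * v2 := by linarith
    have k3 : (t * u1) ^ 2 + (t * u2) ^ 2 = t * s * (u1 * v1 + u2 * v2) := by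
      rw [pow_two, pow_two]; nth_rw 2 [k1]; nth_rw 2 [k2]; ring
    have k4 : t * s * (u1 * v1 + u2 * v2) ≤ 0 :=
      mul_nonpos_of_nonneg_of_nonpos (mul_nonneg t0 s0) h.le
    have k5 : t * u1 = 0 := by nlinarith [sq_nonneg (t * u1), sq_nonneg (t * u2)]
    have k6 : t * u2 = 0 := by nlinarith [sq_nonneg (t * u1), sq_nonneg (t * u2)]
    ext <;> simp [u1, u2] at * <;> tauto

lemma wedge_or_dotp_neg_left {u v : Plane} :
    (wedge (-u) v ≠ 0 ∨ dotp (-u) v < 0) ↔ (wedge u v ≠ 0 ∨ 0 < dotp u v) := by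
  have h1 : wedge (-u) v = - wedge u v := by simp [wedge]; ring
  have h2 : dotp (-u) v = - dotp u v := by simp [dotp]; ring
  rw [h1, h2]; simp

lemma eq_of_mem_consecutive_segments {a b c z : Plane}
    (h : wedge (b - a) (c - b) ≠ 0 ∨ 0 < dotp (b - a) (c - b))
    (h1 : z ∈ segment ℝ a b) (h2 : z ∈ segment ℝ b c) : z = b := by
  rw [segment_symm] at h1
  refine eq_start_of_mem_segments ?_ h1 h2
  rw [← neg_sub b a]
  exact wedge_or_dotp_neg_left.2 h

lemma ne_zero_of_wedge_or_dotp {u v : Plane} (h : wedge u v ≠ 0 ∨ 0 < dotp u v) :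
    u ≠ 0 ∧ v ≠ 0 := by
  constructor <;> rintro rfl <;> simp [wedge, dotp] at h

/-- Two vectors that are not antiparallel have a common direction on their left. -/
lemma exists_common_normal {u v : Plane} (h : wedge u v ≠ 0 ∨ 0 < dotp u v) :
    ∃ n : Plane, 0 < wedge u n ∧ 0 < wedge v n := by
  by_cases h0 : wedge u v = 0
  · have hd : 0 < dotp u v := h.resolve_left (by simpa using h0)
    refine ⟨(-u.2, u.1), ?_, ?_⟩
    · have hu := (ne_zero_of_wedge_or_dotp h).1
      have := sqDist_pos (p := 0) (z := u) hu.symm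
      simp only [sqDist, wedge, Prod.fst_zero, Prod.snd_zero] at *
      nlinarith
    · simp only [wedge, dotp] at *; nlinarith
  · rcases lt_or_gt_of_ne h0 with h1 | h1
    · refine ⟨u - v, ?_, ?_⟩ <;> simp only [wedge, Prod.fst_sub, Prod.snd_sub] at * <;> nlinarith
    · refine ⟨v - u, ?_, ?_⟩ <;> simp only [wedge, Prod.fst_sub, Prod.snd_sub] at * <;> nlinarith

/-- Disjointness of segments is stable under perturbation of the endpoints. -/
lemma eventually_disjoint_segments {X : Type*} [TopologicalSpace X] {x₀ : X}
    {a b c d : X → Plane} (ha : Continuous a) (hb : Continuous b) (hc : Continuous c)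
    (hd : Continuous d) (h : Disjoint (segment ℝ (a x₀) (b x₀)) (segment ℝ (c x₀) (d x₀))) :
    ∀ᶠ x in 𝓝 x₀, Disjoint (segment ℝ (a x) (b x)) (segment ℝ (c x) (d x)) := by
  have key : ∀ᶠ x in 𝓝 x₀, ∀ y ∈ (Icc (0 : ℝ) 1) ×ˢ (Icc (0 : ℝ) 1),
      a x + y.1 • (b x - a x) ≠ c x + y.2 • (d x - c x) := by
    refine (isCompact_Icc.prod isCompact_Icc).eventually_forall_of_forall_eventually ?_
    rintro ⟨t, s⟩ ⟨ht, hs⟩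
    have h1 : Continuous fun z : X × ℝ × ℝ => a z.1 + z.2.1 • (b z.1 - a z.1) := by fun_prop
    have h2 : Continuous fun z : X × ℝ × ℝ => c z.1 + z.2.2 • (d z.1 - c z.1) := by fun_prop
    refine (isOpen_ne_fun h1 h2).mem_nhds fun he => ?_
    exact Set.disjoint_left.1 h (mem_segment_iff.2 ⟨t, ht.1, ht.2, rfl⟩)
      (mem_segment_iff.2 ⟨s, hs.1, hs.2, he⟩)
  filter_upwards [key] with x hx
  rw [Set.disjoint_left]
  intro z hz hz'
  obtain ⟨t, t0, t1, rfl⟩ := mem_segment_iff.1 hz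
  obtain ⟨s, s0, s1, e⟩ := mem_segment_iff.1 hz'
  exact hx (t, s) ⟨⟨t0, t1⟩, s0, s1⟩ e

lemma eventually_wedge_or_dotp {X : Type*} [TopologicalSpace X] {x₀ : X} {u v : X → Plane}
    (hu : Continuous u) (hv : Continuous v)
    (h : wedge (u x₀) (v x₀) ≠ 0 ∨ dotp (u x₀) (v x₀) < 0) :
    ∀ᶠ x in 𝓝 x₀, wedge (u x) (v x) ≠ 0 ∨ dotp (u x) (v x) < 0 := by
  rcases h with h | h
  · filter_upwards [(isOpen_ne_fun (continuous_wedge hu hv) continuous_const).mem_nhds h] with x hx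
    exact Or.inl hx
  · filter_upwards [(isOpen_lt (continuous_dotp hu hv) continuous_const).mem_nhds h] with x hx
    exact Or.inr hx

/-- Parallel copies of two consecutive segments only meet in the common end of a copy. -/
lemma eq_of_mem_consecutive_copies {a b p n z : Plane} {s s' : ℝ}
    (ha : 0 < wedge (p + s • n - a) n) (hb : 0 < wedge (b - (p + s' • n)) n)
    (h1 : z ∈ segment ℝ a (p + s • n)) (h2 : z ∈ segment ℝ (p + s' • n) b) :
    s = s' ∧ z = p + s • n := by
  rw [segment_symm] at h1
  obtain ⟨t, t0, -, rfl⟩ := mem_segment_iff.1 h1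
  obtain ⟨r, r0, -, e⟩ := mem_segment_iff.1 h2
  have e1 := congrArg Prod.fst e
  have e2 := congrArg Prod.snd e
  simp only [Prod.fst_add, Prod.snd_add, Prod.smul_fst, Prod.smul_snd, smul_eq_mul, Prod.fst_sub,
    Prod.snd_sub, wedge] at *
  set A := (p.1 + s * n.1 - a.1) * n.2 - (p.2 + s * n.2 - a.2) * n.1 with hA
  set B := (b.1 - (p.1 + s' * n.1)) * n.2 - (b.2 - (p.2 + s' * n.2)) * n.1 with hB
  have k : t * A + r * B = 0 := by
    rw [hA, hB]; linear_combination - n.2 * e1 + n.1 * e2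
  have kt : t = 0 := by
    have := mul_nonneg t0 ha.le
    have := mul_nonneg r0 hb.le
    have : t * A = 0 := by linarith
    exact (mul_eq_zero.1 this).resolve_right ha.ne'
  have kr : r = 0 := by
    subst kt
    have : r * B = 0 := by linarith
    exact (mul_eq_zero.1 this).resolve_right hb.ne'
  subst kt kr
  refine ⟨?_, by simp⟩
  by_contra hne
  have hne' := sub_ne_zero.2 hne
  have n1 : n.1 = 0 := by
    have : (s - s') * n.1 = 0 := by linarith
    exact (mul_eq_zero.1 this).resolve_left hne'
  have n2 : n.2 = 0 := by
    have : (s - s') * n.2 = 0 := by linarith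
    exact (mul_eq_zero.1 this).resolve_left hne'
  rw [n1, n2] at hA
  simp at hA
  exact ha.ne' hA

lemma mem_copies_of_segment {a b m n z : Plane} {s s' : ℝ} (hs : s ≠ s')
    (h1 : z ∈ segment ℝ (a + s • m) (b + s • n)) (h2 : z ∈ segment ℝ (a + s' • m) (b + s' • n)) :
    ∃ t : ℝ, 0 ≤ t ∧ t ≤ 1 ∧ z = (a + s • m) + t • ((b + s • n) - (a + s • m)) ∧
      (1 - t) * wedge (b + s' • n - (a + s' • m)) m +
        t * wedge (b + s' • n - (a + s' • m)) n = 0 := by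
  obtain ⟨t, t0, t1, rfl⟩ := mem_segment_iff.1 h1
  obtain ⟨r, r0, -, e⟩ := mem_segment_iff.1 h2
  refine ⟨t, t0, t1, rfl, ?_⟩
  have e1 := congrArg Prod.fst e
  have e2 := congrArg Prod.snd e
  simp only [Prod.fst_add, Prod.snd_add, Prod.smul_fst, Prod.smul_snd, smul_eq_mul, Prod.fst_sub,
    Prod.snd_sub, wedge] at *
  refine (mul_eq_zero.1 (?_ : (s - s') * _ = 0)).resolve_left (sub_ne_zero.2 hs)
  linear_combination (b.1 + s' * n.1 - (a.1 + s' * m.1)) * e2 -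
    (b.2 + s' * n.2 - (a.2 + s' * m.2)) * e1

lemma sqDist_lineMap (p a b : Plane) (t : ℝ) :
    sqDist p (a + t • (b - a)) =
      (1 - t) * sqDist p a + t * sqDist p b - t * (1 - t) * sqDist a b := by
  simp [sqDist]; ring

lemma sqDist_le_of_mem_segment {p a b z : Plane} {ρ : ℝ} (ha : sqDist p a ≤ ρ)
    (hb : sqDist p b ≤ ρ) (hz : z ∈ segment ℝ a b) : sqDist p z ≤ ρ := by
  obtain ⟨t, t0, t1, rfl⟩ := mem_segment_iff.1 hz
  rw [sqDist_lineMap]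
  nlinarith [sqDist_nonneg a b, mul_nonneg t0 (sub_nonneg.2 t1),
    mul_nonneg (mul_nonneg t0 (sub_nonneg.2 t1)) (sqDist_nonneg a b)]

lemma eq_or_eq_of_mem_segment_of_sqDist {p a b z : Plane} {ρ : ℝ} (ha : sqDist p a ≤ ρ)
    (hb : sqDist p b ≤ ρ) (hz : z ∈ segment ℝ a b) (h : sqDist p z = ρ) : z = a ∨ z = b := by
  by_cases hab : a = b
  · subst hab; simp at hz; exact Or.inl hz
  obtain ⟨t, t0, t1, rfl⟩ := mem_segment_iff.1 hz
  rw [sqDist_lineMap] at h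
  have h1 := sqDist_pos hab
  have h2 : t * (1 - t) * sqDist a b ≤ 0 := by nlinarith
  have h3 : t * (1 - t) = 0 := by
    have := mul_nonneg t0 (sub_nonneg.2 t1)
    by_contra hne
    have : 0 < t * (1 - t) := lt_of_le_of_ne this (Ne.symm hne)
    nlinarith [mul_pos this h1]
  rcases mul_eq_zero.1 h3 with h4 | h4
  · left; simp [h4]
  · right; rw [show t = 1 by linarith]; simp

/-- Intersecting chords of a circle with four distinct endpoints are not parallel. -/
lemma wedge_ne_zero_of_chords {p a b c d : Plane} {ρ : ℝ} (ha : sqDist p a = ρ)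
    (hb : sqDist p b = ρ) (hc : sqDist p c = ρ) (hab : a ≠ b)
    (hca : c ≠ a) (hcb : c ≠ b) (h : ¬ Disjoint (segment ℝ a b) (segment ℝ c d)) :
    wedge (b - a) (d - c) ≠ 0 := by
  intro h0
  obtain ⟨z, hz, hz'⟩ := Set.not_disjoint_iff.1 h
  obtain ⟨t, -, -, rfl⟩ := mem_segment_iff.1 hz
  obtain ⟨s, -, -, e⟩ := mem_segment_iff.1 hz'
  obtain ⟨μ, hμ⟩ : ∃ μ : ℝ, d - c = μ • (b - a) := by
    have hpos := sqDist_pos hab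
    refine ⟨dotp (b - a) (d - c) / sqDist a b, ?_⟩
    simp only [wedge, Prod.fst_sub, Prod.snd_sub] at h0
    ext <;> simp only [dotp, Prod.fst_sub, Prod.snd_sub, Prod.smul_fst, Prod.smul_snd, smul_eq_mul]
      <;> rw [div_mul_eq_mul_div, eq_div_iff hpos.ne'] <;> simp only [sqDist]
    · linear_combination (-(b.2 - a.2)) * h0
    · linear_combination (b.1 - a.1) * h0
  have hcκ : c = a + (t - s * μ) • (b - a) := by
    rw [hμ] at e
    rw [sub_smul, mul_smul, add_sub, e]; simp
  generalize t - s * μ = κ at hcκ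
  rw [hcκ, sqDist_lineMap, ha, hb] at hc
  have : κ * (1 - κ) = 0 := by
    refine (mul_eq_zero.1 (?_ : _ * sqDist a b = 0)).resolve_right (sqDist_pos hab).ne'
    linarith
  rcases mul_eq_zero.1 this with h4 | h4
  · exact hca (by simp [hcκ, h4])
  · exact hcb (by rw [hcκ, show κ = 1 by linarith]; simp)

lemma wedge_or_dotp_of_sqDist_eq {p a b : Plane} {ρ : ℝ} (hρ : 0 < ρ) (ha : sqDist p a = ρ)
    (hb : sqDist p b = ρ) (hab : a ≠ b) :
    wedge (a - p) (b - p) ≠ 0 ∨ dotp (a - p) (b - p) < 0 := by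
  by_contra! hcon
  obtain ⟨h0, h1⟩ := hcon
  have hpos := sqDist_pos hab
  simp only [wedge, dotp, sqDist, Prod.fst_sub, Prod.snd_sub] at *
  set u1 := a.1 - p.1 with hu1
  set u2 := a.2 - p.2 with hu2
  set v1 := b.1 - p.1 with hv1
  set v2 := b.2 - p.2 with hv2
  have e : b.1 - a.1 = v1 - u1 := by rw [hv1, hu1]; ring
  have e' : b.2 - a.2 = v2 - u2 := by rw [hv2, hu2]; ring
  rw [e, e'] at hpos
  have k : (u1 * v1 + u2 * v2) ^ 2 = ρ ^ 2 := by
    calc _ = (u1 ^ 2 + u2 ^ 2) * (v1 ^ 2 + v2 ^ 2) - (u1 * v2 - u2 * v1) ^ 2 := by ring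
      _ = ρ ^ 2 := by rw [ha, hb, h0]; ring
  have k2 : u1 * v1 + u2 * v2 = ρ := by
    rcases sq_eq_sq_iff_eq_or_eq_neg.1 k with h | h <;> linarith
  nlinarith

end PlaneGeometry

section Arcs

open Filter Topology

/-- `A` is a simple arc from `x` to `y`. -/
def IsArc (A : Set Plane) (x y : Plane) : Prop :=
  ∃ f : ℝ → Plane, Continuous f ∧ InjOn f (Icc 0 1) ∧ f '' Icc 0 1 = A ∧ f 0 = x ∧ f 1 = y

lemma IsArc.symm {A : Set Plane} {x y : Plane} (h : IsArc A x y) : IsArc A y x := by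
  obtain ⟨f, hf, hinj, hA, h0, h1⟩ := h
  have maps : ∀ t ∈ Icc (0 : ℝ) 1, 1 - t ∈ Icc (0 : ℝ) 1 := fun t ht =>
    ⟨by linarith [ht.2], by linarith [ht.1]⟩
  refine ⟨fun t => f (1 - t), by fun_prop, ?_, ?_, by simpa, by simpa⟩
  · intro s hs t ht h
    linarith [hinj (maps s hs) (maps t ht) h]
  · rw [← hA]
    ext z
    constructor
    · rintro ⟨t, ht, rfl⟩; exact ⟨1 - t, maps t ht, rfl⟩
    · rintro ⟨t, ht, rfl⟩; exact ⟨1 - t, maps t ht, by simp⟩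

lemma isArc_segment {a b : Plane} (h : a ≠ b) : IsArc (segment ℝ a b) a b := by
  refine ⟨fun t => a + t • (b - a), by fun_prop, ?_, (segment_eq_image' ..).symm, by simp, by simp⟩
  intro s _ t _ hst
  have : s • (b - a) = t • (b - a) := by simpa using hst
  exact smul_left_injective ℝ (sub_ne_zero.2 h.symm) this

lemma isArc_image_Icc {f : ℝ → Plane} {a b : ℝ} (hf : Continuous f) (hinj : InjOn f (Icc a b))
    (hab : a < b) : IsArc (f '' Icc a b) (f a) (f b) := by
  refine ⟨fun t => f (a + t * (b - a)), by fun_prop, ?_, ?_, by simp, by simp⟩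
  · intro s hs t ht hst
    have hpos : 0 < b - a := sub_pos.2 hab
    have mem : ∀ r ∈ Icc (0 : ℝ) 1, a + r * (b - a) ∈ Icc a b := fun r hr =>
      ⟨by nlinarith [hr.1], by nlinarith [hr.2]⟩
    have := hinj (mem s hs) (mem t ht) hst
    exact mul_right_cancel₀ hpos.ne' (by linarith : s * (b - a) = t * (b - a))
  · have hpos : 0 < b - a := sub_pos.2 hab
    ext z
    constructor
    · rintro ⟨t, ht, rfl⟩
      exact ⟨_, ⟨by nlinarith [ht.1], by nlinarith [ht.2]⟩, rfl⟩
    · rintro ⟨t, ht, rfl⟩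
      refine ⟨(t - a) / (b - a), ⟨div_nonneg (by linarith [ht.1]) hpos.le,
        (div_le_one hpos).2 (by linarith [ht.2])⟩, ?_⟩
      simp only
      rw [div_mul_cancel₀ _ hpos.ne']; ring_nf

lemma IsArc.trans {A B : Set Plane} {x y z : Plane} (hA : IsArc A x y) (hB : IsArc B y z)
    (h : A ∩ B ⊆ {y}) : IsArc (A ∪ B) x z := by
  obtain ⟨f, hf, finj, rfl, rfl, f1⟩ := hA
  obtain ⟨g, hg, ginj, rfl, g0, rfl⟩ := hB
  have cross : ∀ s ∈ Icc (0 : ℝ) 1, ∀ t ∈ Icc (0 : ℝ) 1, f s = g t → s = 1 ∧ t = 0 := by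
    intro s hs t ht hst
    have hy : f s = y := h ⟨⟨s, hs, rfl⟩, ⟨t, ht, hst.symm⟩⟩
    exact ⟨finj hs (by simp) (hy.trans f1.symm),
      ginj ht (by simp) ((hst.symm.trans hy).trans g0.symm)⟩
  refine ⟨fun t => if t ≤ 1 / 2 then f (2 * t) else g (2 * t - 1), ?_, ?_, ?_, ?_, ?_⟩
  · refine Continuous.if_le (by fun_prop) (by fun_prop) continuous_id continuous_const ?_
    rintro t rfl
    norm_num [f1, g0]
  · intro s hs t ht hst
    simp only at hst
    split_ifs at hst with h1 h2 h2
    · linarith [finj ⟨by linarith [hs.1], by linarith⟩ ⟨by linarith [ht.1], by linarith⟩ hst]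
    · obtain ⟨k1, k2⟩ := cross (2 * s) ⟨by linarith [hs.1], by linarith⟩ (2 * t - 1)
        ⟨by linarith, by linarith [ht.2]⟩ hst
      linarith
    · obtain ⟨k1, k2⟩ := cross (2 * t) ⟨by linarith [ht.1], by linarith⟩ (2 * s - 1)
        ⟨by linarith, by linarith [hs.2]⟩ hst.symm
      linarith
    · linarith [ginj ⟨by linarith, by linarith [hs.2]⟩ ⟨by linarith, by linarith [ht.2]⟩ hst]
  · ext w
    constructor
    · rintro ⟨t, ht, rfl⟩
      simp only
      split_ifs with h1
      · exact Or.inl ⟨_, ⟨by linarith [ht.1], by linarith⟩, rfl⟩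
      · exact Or.inr ⟨_, ⟨by linarith, by linarith [ht.2]⟩, rfl⟩
    · rintro (⟨t, ht, rfl⟩ | ⟨t, ht, rfl⟩)
      · refine ⟨t / 2, ⟨by linarith [ht.1], by linarith [ht.2]⟩, ?_⟩
        simp only
        rw [if_pos (by linarith [ht.2])]; ring_nf
      · rcases ht.1.eq_or_lt with h0 | h0
        · refine ⟨1 / 2, by norm_num, ?_⟩
          norm_num [f1, ← h0, g0]
        · refine ⟨(t + 1) / 2, ⟨by linarith, by linarith [ht.2]⟩, ?_⟩
          simp only
          rw [if_neg (by linarith)]; ring_nf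
  · norm_num
  · norm_num

/-- The union of two arcs with a common end contains an arc joining the other two ends. -/
lemma IsArc.exists_isArc_subset_union {A B : Set Plane} {x m y : Plane} (hA : IsArc A x m)
    (hB : IsArc B m y) (hx : x ∉ B) (hy : y ∉ A) : ∃ C ⊆ A ∪ B, IsArc C x y := by
  obtain ⟨f, hf, finj, rfl, rfl, rfl⟩ := hA
  obtain ⟨g, hg, ginj, rfl, g0, rfl⟩ := hB
  have hcomp : IsCompact (Icc (0 : ℝ) 1 ∩ f ⁻¹' (g '' Icc 0 1)) :=
    isCompact_Icc.inter_right ((isCompact_Icc.image hg).isClosed.preimage hf)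
  have hmem := hcomp.sInf_mem ⟨1, by simp, ⟨0, by simp, g0⟩⟩
  have hle : ∀ t ∈ Icc (0 : ℝ) 1, f t ∈ g '' Icc 0 1 →
      sInf (Icc (0 : ℝ) 1 ∩ f ⁻¹' (g '' Icc 0 1)) ≤ t := fun t h1 h2 =>
    csInf_le hcomp.bddBelow ⟨h1, h2⟩
  generalize sInf (Icc (0 : ℝ) 1 ∩ f ⁻¹' (g '' Icc 0 1)) = t₀ at hmem hle
  obtain ⟨ht, s₀, hs, hst⟩ := hmem
  have t0 : 0 < t₀ := by
    refine ht.1.lt_of_ne ?_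
    rintro rfl
    exact hx ⟨s₀, hs, hst⟩
  have s1 : s₀ < 1 := by
    refine hs.2.lt_of_ne ?_
    rintro rfl
    exact hy ⟨t₀, ht, hst.symm⟩
  have a1 := isArc_image_Icc hf (finj.mono (Icc_subset_Icc le_rfl ht.2)) t0
  have a2 := isArc_image_Icc hg (ginj.mono (Icc_subset_Icc hs.1 le_rfl)) s1
  rw [hst] at a2
  refine ⟨_, ?_, a1.trans a2 ?_⟩
  · exact union_subset_union (image_mono (Icc_subset_Icc le_rfl ht.2))
      (image_mono (Icc_subset_Icc hs.1 le_rfl))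
  · rintro z ⟨⟨t, htt, rfl⟩, ⟨s, hss, hz⟩⟩
    have := hle t ⟨htt.1, htt.2.trans ht.2⟩ ⟨s, ⟨hs.1.trans hss.1, hss.2⟩, hz⟩
    rw [le_antisymm htt.2 this]; rfl

/-- The polygonal chain with the first `k + 1` vertices `P 0, …, P k`. -/
def polyChain (P : ℕ → Plane) (k : ℕ) : Set Plane :=
  ⋃ m ∈ Iio k, segment ℝ (P m) (P (m + 1))

lemma mem_polyChain {P : ℕ → Plane} {k : ℕ} {z : Plane} :
    z ∈ polyChain P k ↔ ∃ m < k, z ∈ segment ℝ (P m) (P (m + 1)) := by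
  simp [polyChain]

/-- A polygonal chain without self-intersections is a simple arc. -/
lemma isArc_polyChain {P : ℕ → Plane} {k : ℕ} (hk : 0 < k) (hne : ∀ m < k, P m ≠ P (m + 1))
    (hnear : ∀ m, m + 1 < k → segment ℝ (P m) (P (m + 1)) ∩
      segment ℝ (P (m + 1)) (P (m + 2)) ⊆ {P (m + 1)})
    (hfar : ∀ m n, m + 2 ≤ n → n < k →
      Disjoint (segment ℝ (P m) (P (m + 1))) (segment ℝ (P n) (P (n + 1)))) :
    IsArc (polyChain P k) (P 0) (P k) := by
  induction k with
  | zero => omega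
  | succ k ih =>
    rcases Nat.eq_zero_or_pos k with rfl | hk'
    · have : polyChain P (0 + 1) = segment ℝ (P 0) (P 1) := by
        ext z; simp [mem_polyChain]
      rw [this]; exact isArc_segment (hne 0 (by omega))
    · have h1 := ih hk' (fun m hm => hne m (by omega)) (fun m hm => hnear m (by omega))
        (fun m n hm hn => hfar m n hm (by omega))
      have hu : polyChain P (k + 1) = polyChain P k ∪ segment ℝ (P k) (P (k + 1)) := by
        ext z
        simp only [mem_polyChain, mem_union, Nat.lt_succ_iff_lt_or_eq]
        constructor
        · rintro ⟨m, hm | rfl, hz⟩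
          · exact Or.inl ⟨m, hm, hz⟩
          · exact Or.inr hz
        · rintro (⟨m, hm, hz⟩ | hz)
          · exact ⟨m, Or.inl hm, hz⟩
          · exact ⟨k, Or.inr rfl, hz⟩
      rw [hu]
      refine h1.trans (isArc_segment (hne k (by omega))) ?_
      rintro z ⟨hz, hz'⟩
      obtain ⟨m, hm, hzm⟩ := mem_polyChain.1 hz
      rcases Nat.lt_or_ge m (k - 1) with h | h
      · exact absurd hz' (Set.disjoint_left.1 (hfar m k (by omega) (by omega)) hzm)
      · obtain rfl : k = m + 1 := by omega
        exact hnear m (by omega) ⟨hzm, hz'⟩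

end Arcs

namespace Drawing

variable {V : Type*} {G : SimpleGraph V}

/-- The whole arc of an edge, including its endpoints. -/
def arcSet (D : Drawing G) (e : G.edgeSet) : Set Plane := D.arc e '' Icc 0 1

lemma interOf_eq (D : Drawing G) (e : G.edgeSet) :
    D.interOf e = D.arcSet e \ range D.vert := by
  obtain ⟨x, y, -, hx, hy⟩ := D.arc_ends e
  ext z
  constructor
  · rintro ⟨t, ht, rfl⟩
    refine ⟨⟨t, Ioo_subset_Icc_self ht, rfl⟩, ?_⟩
    rintro ⟨v, hv⟩
    rcases D.arc_avoid e t (Ioo_subset_Icc_self ht) ⟨v, hv.symm⟩ with h | h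
    · exact ht.1.ne' h
    · exact ht.2.ne h
  · rintro ⟨⟨t, ht, rfl⟩, hv⟩
    refine ⟨t, ⟨ht.1.lt_of_ne ?_, ht.2.lt_of_ne ?_⟩, rfl⟩
    · rintro rfl; exact hv ⟨x, hx.symm⟩
    · rintro rfl; exact hv ⟨y, hy.symm⟩

lemma exists_continuous_arc (D : Drawing G) (e : G.edgeSet) :
    ∃ f : ℝ → Plane, Continuous f ∧ EqOn f (D.arc e) (Icc 0 1) := by
  refine ⟨IccExtend zero_le_one ((Icc (0 : ℝ) 1).domRestrict (D.arc e)),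
    (continuousOn_iff_continuous_domRestrict.1 (D.arc_cont e)).Icc_extend', ?_⟩
  intro t ht
  rw [IccExtend_of_mem _ _ ht]; rfl

lemma isArc_arcSet (D : Drawing G) (e : G.edgeSet) :
    IsArc (D.arcSet e) (D.arc e 0) (D.arc e 1) := by
  obtain ⟨f, hf, he⟩ := D.exists_continuous_arc e
  exact ⟨f, hf, (D.arc_injOn e).congr he.symm, he.image_eq, he (by simp), he (by simp)⟩

lemma vert_mem_arcSet (D : Drawing G) {e : G.edgeSet} {v : V} (h : D.vert v ∈ D.arcSet e) :
    v ∈ (e : Sym2 V) := by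
  obtain ⟨x, y, hxy, hx, hy⟩ := D.arc_ends e
  obtain ⟨t, ht, htv⟩ := h
  rw [hxy, Sym2.mem_iff]
  rcases D.arc_avoid e t ht ⟨v, htv⟩ with rfl | rfl
  · exact Or.inl (D.vert_inj (htv.symm.trans hx))
  · exact Or.inr (D.vert_inj (htv.symm.trans hy))

lemma isArc_arcSet_of_eq (D : Drawing G) {e : G.edgeSet} {x y : V} (h : (e : Sym2 V) = s(x, y)) :
    IsArc (D.arcSet e) (D.vert x) (D.vert y) := by
  obtain ⟨x', y', hxy, hx, hy⟩ := D.arc_ends e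
  have := D.isArc_arcSet e
  rw [hx, hy] at this
  rw [h, Sym2.eq_iff] at hxy
  rcases hxy with ⟨rfl, rfl⟩ | ⟨rfl, rfl⟩
  · exact this
  · exact this.symm

/-- A family of arcs joining the right vertices and avoiding the others is a drawing. -/
lemma exists_of_isArc {vert : V → Plane} (hinj : Function.Injective vert)
    (A : G.edgeSet → Set Plane)
    (hA : ∀ e : G.edgeSet, ∃ x y, (e : Sym2 V) = s(x, y) ∧ IsArc (A e) (vert x) (vert y))
    (hv : ∀ (e : G.edgeSet) (v : V), vert v ∈ A e → v ∈ (e : Sym2 V)) :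
    ∃ D : Drawing G, D.vert = vert ∧ ∀ e, D.arcSet e = A e := by
  choose x y hxy f hf finj fim f0 f1 using hA
  refine ⟨⟨vert, hinj, f, fun e => (hf e).continuousOn, finj,
    fun e => ⟨x e, y e, hxy e, f0 e, f1 e⟩, ?_⟩, rfl, fim⟩
  rintro e t ht ⟨v, htv⟩
  have := hv e v (by rw [← fim e]; exact ⟨t, ht, htv⟩)
  rw [hxy, Sym2.mem_iff] at this
  rcases this with rfl | rfl
  · exact Or.inl (finj e ht (by simp) (htv.trans (f0 e).symm))
  · exact Or.inr (finj e ht (by simp) (htv.trans (f1 e).symm))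

end Drawing

section Counting

lemma finite_setOf_triples {ι : Type*} [Finite ι] {B : ι → ι → Set Plane}
    (hB : ∀ i j, (B i j).Finite) : {t : Plane × ι × ι | t.1 ∈ B t.2.1 t.2.2}.Finite := by
  have : {t : Plane × ι × ι | t.1 ∈ B t.2.1 t.2.2} ⊆
      ⋃ ij : ι × ι, (fun p => (p, ij)) '' B ij.1 ij.2 := by
    rintro ⟨p, i, j⟩ h
    exact mem_iUnion.2 ⟨(i, j), p, h, rfl⟩
  exact (finite_iUnion fun ij => (hB _ _).image _).subset this

lemma ncard_setOf_triples {ι : Type*} [Fintype ι] {B : ι → ι → Set Plane}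
    (hB : ∀ i j, (B i j).Finite) :
    {t : Plane × ι × ι | t.1 ∈ B t.2.1 t.2.2}.ncard = ∑ i, ∑ j, (B i j).ncard := by
  have (ij : ι × ι) : Finite (B ij.1 ij.2) := hB _ _
  rw [← Fintype.sum_prod_type', ← Nat.card_coe_set_eq]
  calc _ = Nat.card (Σ ij : ι × ι, B ij.1 ij.2) := Nat.card_congr
        { toFun := fun t => ⟨t.1.2, t.1.1, t.2⟩
          invFun := fun s => ⟨(s.2.1, s.1), s.2.2⟩
          left_inv := fun _ => rfl
          right_inv := fun _ => rfl }
    _ = _ := by rw [Nat.card_sigma]; rfl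

/-- There is a choice function for which a pair sum, weighted by the sizes of the fibers, is at
most the full sum over all pairs: average over all choice functions. -/
lemma exists_choice_sum_le {E : Type*} [Fintype E] [DecidableEq E] (w : E → ℕ)
    (hw : ∀ e, 0 < w e) (N : (Σ e, Fin (w e)) → (Σ e, Fin (w e)) → ℕ) :
    ∃ c : ∀ e, Fin (w e), (∑ e, ∑ f, if e = f then 0 else w e * w f * N ⟨e, c e⟩ ⟨f, c f⟩) ≤
      ∑ q, ∑ q', if q.1 = q'.1 then 0 else N q q' := by
  by_contra! hcon
  have hcard (e f : E) (hef : e ≠ f) (i : Fin (w e)) (j : Fin (w f)) :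
      w e * w f * (Finset.univ.filter fun c : ∀ e, Fin (w e) => c e = i ∧ c f = j).card =
        ∏ g, w g := by
    have : (Finset.univ.filter fun c : ∀ e, Fin (w e) => c e = i ∧ c f = j) =
        Fintype.piFinset fun g => Finset.univ.filter fun k : Fin (w g) =>
          (g = e → (k : ℕ) = i) ∧ (g = f → (k : ℕ) = j) := by
      ext c
      simp only [Finset.mem_filter, Finset.mem_univ, true_and, Fintype.mem_piFinset]
      constructor
      · rintro ⟨rfl, rfl⟩ g
        exact ⟨by rintro rfl; rfl, by rintro rfl; rfl⟩
      · intro h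
        exact ⟨Fin.ext ((h e).1 rfl), Fin.ext ((h f).2 rfl)⟩
    rw [this, Fintype.card_piFinset, ← Finset.mul_prod_erase Finset.univ w (Finset.mem_univ e),
      ← Finset.mul_prod_erase (Finset.univ.erase e) w (a := f) (by simp [hef.symm]),
      ← Finset.mul_prod_erase Finset.univ _ (Finset.mem_univ e),
      ← Finset.mul_prod_erase (Finset.univ.erase e) _ (a := f) (by simp [hef.symm])]
    have h1 : (Finset.univ.filter fun k : Fin (w e) =>
        (e = e → (k : ℕ) = i) ∧ (e = f → (k : ℕ) = j)).card = 1 := by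
      rw [Finset.card_eq_one]
      exact ⟨i, by ext k; simp [hef, Fin.ext_iff]⟩
    have h2 : (Finset.univ.filter fun k : Fin (w f) =>
        (f = e → (k : ℕ) = i) ∧ (f = f → (k : ℕ) = j)).card = 1 := by
      rw [Finset.card_eq_one]
      exact ⟨j, by ext k; simp [hef.symm, Fin.ext_iff]⟩
    have h3 : ∀ g ∈ (Finset.univ.erase e).erase f, (Finset.univ.filter fun k : Fin (w g) =>
        (g = e → (k : ℕ) = i) ∧ (g = f → (k : ℕ) = j)).card = w g := by
      intro g hg
      simp only [Finset.mem_erase, Finset.mem_univ, and_true] at hg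
      simp [hg.1, hg.2]
    rw [h1, h2, Finset.prod_congr rfl h3]
    ring
  have hsum : (∑ c : ∀ e, Fin (w e), ∑ e, ∑ f,
      if e = f then 0 else w e * w f * N ⟨e, c e⟩ ⟨f, c f⟩) =
      (∏ g, w g) * ∑ q : (Σ e, Fin (w e)), ∑ q' : (Σ e, Fin (w e)),
        if q.1 = q'.1 then 0 else N q q' := by
    rw [Finset.sum_comm, Fintype.sum_sigma, Finset.mul_sum]
    refine Finset.sum_congr rfl fun e _ => ?_
    simp_rw [Fintype.sum_sigma]
    rw [Finset.sum_comm, Finset.sum_comm (s := (Finset.univ : Finset (Fin (w e)))),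
      Finset.mul_sum]
    refine Finset.sum_congr rfl fun f _ => ?_
    by_cases hef : e = f
    · simp [hef]
    simp only [hef, if_false]
    simp_rw [Finset.mul_sum]
    have (c : ∀ e, Fin (w e)) : w e * w f * N ⟨e, c e⟩ ⟨f, c f⟩ =
        ∑ i : Fin (w e), ∑ j : Fin (w f),
          if c e = i ∧ c f = j then w e * w f * N ⟨e, i⟩ ⟨f, j⟩ else 0 := by
      rw [Finset.sum_eq_single (c e), Finset.sum_eq_single (c f)] <;> simp +contextual [eq_comm]
    simp_rw [this]
    rw [Finset.sum_comm]
    refine Finset.sum_congr rfl fun i _ => ?_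
    rw [Finset.sum_comm]
    refine Finset.sum_congr rfl fun j _ => ?_
    rw [← Finset.sum_filter, Finset.sum_const, smul_eq_mul, ← hcard e f hef i j]
    ring
  have hlt : ∑ _c : ∀ e, Fin (w e), (∑ q : (Σ e, Fin (w e)), ∑ q' : (Σ e, Fin (w e)),
      if q.1 = q'.1 then 0 else N q q') < ∑ c : ∀ e, Fin (w e), ∑ e, ∑ f,
      if e = f then 0 else w e * w f * N ⟨e, c e⟩ ⟨f, c f⟩ := by
    refine Finset.sum_lt_sum_of_nonempty ?_ fun c _ => hcon c
    exact ⟨fun e => ⟨0, hw e⟩, Finset.mem_univ _⟩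
  rw [hsum, Finset.sum_const, smul_eq_mul, Finset.card_univ, Fintype.card_pi] at hlt
  simp at hlt

end Counting

namespace Drawing

variable {V : Type*} {G : SimpleGraph V}

lemma mem_crossSet_mk {D : Drawing G} {p : Plane} {e f : G.edgeSet} :
    (p, s(e, f)) ∈ D.CrossSet ↔ e ≠ f ∧ p ∈ D.interOf e ∧ p ∈ D.interOf f := by
  constructor
  · rintro ⟨a, b, hab, h, ha, hb⟩
    rw [Sym2.eq_iff] at h
    rcases h with ⟨rfl, rfl⟩ | ⟨rfl, rfl⟩
    · exact ⟨hab, ha, hb⟩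
    · exact ⟨hab.symm, hb, ha⟩
  · rintro ⟨hef, he, hf⟩
    exact ⟨e, f, hef, rfl, he, hf⟩

lemma finite_inter_of_crossSet_finite {D : Drawing G} (hD : D.CrossSet.Finite) {e f : G.edgeSet}
    (hef : e ≠ f) : (D.interOf e ∩ D.interOf f).Finite := by
  refine (hD.image Prod.fst).subset ?_
  rintro p ⟨he, hf⟩
  exact ⟨(p, s(e, f)), mem_crossSet_mk.2 ⟨hef, he, hf⟩, rfl⟩

lemma crossSet_finite [Finite G.edgeSet] {D : Drawing G}
    (h : ∀ e f, e ≠ f → (D.interOf e ∩ D.interOf f).Finite) : D.CrossSet.Finite := by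
  have : D.CrossSet ⊆ ⋃ ef : {ef : G.edgeSet × G.edgeSet // ef.1 ≠ ef.2},
      (fun p => (p, s(ef.1.1, ef.1.2))) '' (D.interOf ef.1.1 ∩ D.interOf ef.1.2) := by
    rintro ⟨p, -⟩ ⟨e, f, hef, rfl, he, hf⟩
    exact mem_iUnion.2 ⟨⟨(e, f), hef⟩, p, ⟨he, hf⟩, rfl⟩
  exact (finite_iUnion fun ef => (h _ _ ef.2).image _).subset this

open Classical in
/-- The weighted number of crossings as a sum over ordered pairs of edges. -/
lemma two_mul_wcount [Fintype G.edgeSet] {D : Drawing G} (hD : D.CrossSet.Finite)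
    (w : Sym2 V → ℕ) : 2 * D.wcount w = ∑ e : G.edgeSet, ∑ f : G.edgeSet,
      if e = f then 0 else w e * w f * (D.interOf e ∩ D.interOf f).ncard := by
  rw [wcount, finsum_mem_eq_finite_toFinset_sum _ hD, Finset.mul_sum]
  have h1 : ∀ x ∈ hD.toFinset, 2 * Sym2.lift ⟨fun e f : G.edgeSet => w e * w f,
      fun e f => mul_comm _ _⟩ x.2 = ∑ e : G.edgeSet, ∑ f : G.edgeSet,
        if e ≠ f ∧ x.2 = s(e, f) then w e * w f else 0 := by
    rintro ⟨p, z⟩ hx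
    obtain ⟨a, b, hab, h, -, -⟩ := hD.mem_toFinset.1 hx
    simp only at h
    subst h
    rw [← Fintype.sum_prod_type', ← Finset.sum_filter]
    have : (Finset.univ.filter fun ef : G.edgeSet × G.edgeSet =>
        ef.1 ≠ ef.2 ∧ s(a, b) = s(ef.1, ef.2)) = {(a, b), (b, a)} := by
      ext ⟨e, f⟩
      simp only [Finset.mem_filter, Finset.mem_univ, true_and, Sym2.eq_iff, Finset.mem_insert,
        Finset.mem_singleton, Prod.mk.injEq]
      constructor
      · rintro ⟨-, ⟨rfl, rfl⟩ | ⟨rfl, rfl⟩⟩ <;> simp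
      · rintro (⟨rfl, rfl⟩ | ⟨rfl, rfl⟩) <;> simp [hab, hab.symm]
    rw [this, Finset.sum_pair (by simp [hab])]
    simp only [Sym2.lift_mk]
    ring
  rw [Finset.sum_congr rfl h1, Finset.sum_comm]
  refine Finset.sum_congr rfl fun e _ => ?_
  rw [Finset.sum_comm]
  refine Finset.sum_congr rfl fun f _ => ?_
  by_cases hef : e = f
  · simp [hef]
  rw [if_neg hef, ← Finset.sum_filter, Finset.sum_const, smul_eq_mul, mul_comm]
  congr 1
  rw [← Set.ncard_coe_finset, ← Set.ncard_image_of_injective (f := fun p : Plane => (p, s(e, f)))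
    _ fun p p' h => (Prod.mk.inj h).1]
  congr 1
  ext ⟨p, z⟩
  simp only [ne_eq, Finset.coe_filter, Finite.mem_toFinset, mem_ofPred_eq, mem_image, mem_inter_iff,
    Prod.mk.injEq]
  constructor
  · rintro ⟨h, -, rfl⟩
    exact ⟨p, (mem_crossSet_mk.1 h).2, rfl, rfl⟩
  · rintro ⟨p, h, rfl, rfl⟩
    exact ⟨mem_crossSet_mk.2 ⟨hef, h⟩, hef, rfl⟩

open Classical in
lemma two_mul_ncard_crossSet [Fintype G.edgeSet] {D : Drawing G} (hD : D.CrossSet.Finite) :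
    2 * D.CrossSet.ncard = {t : Plane × G.edgeSet × G.edgeSet |
      t.2.1 ≠ t.2.2 ∧ t.1 ∈ D.interOf t.2.1 ∩ D.interOf t.2.2}.ncard := by
  have h1 : D.CrossSet.ncard = D.wcount fun _ => 1 := by
    rw [wcount, finsum_mem_eq_finite_toFinset_sum _ hD, Set.ncard_eq_toFinset_card _ hD,
      Finset.card_eq_sum_ones]
    refine Finset.sum_congr rfl ?_
    rintro ⟨p, z⟩ -
    induction z with
    | _ a b => simp
  rw [h1, two_mul_wcount hD]
  let B (e f : G.edgeSet) : Set Plane := if e = f then ∅ else D.interOf e ∩ D.interOf f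
  have hB (e f) : (B e f).Finite := by
    simp only [B]
    split_ifs with h
    · exact finite_empty
    · exact finite_inter_of_crossSet_finite hD h
  trans ∑ e, ∑ f, (B e f).ncard
  · refine Finset.sum_congr rfl fun e _ => Finset.sum_congr rfl fun f _ => ?_
    simp only [B]
    split_ifs <;> simp
  · rw [← ncard_setOf_triples hB]
    congr 1
    ext ⟨p, e, f⟩
    by_cases h : e = f <;> simp [B, h]

end Drawing

section AssociatedGraph

variable {V : Type*} {G : SimpleGraph V} {w : Sym2 V → ℕ}

lemma assocGraph_adj_inl_inr {v : V} {q : Σ e : G.edgeSet, Fin (w e)} :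
    (assocGraph G w).Adj (Sum.inl v) (Sum.inr q) ↔ v ∈ (q.1 : Sym2 V) := by
  rw [assocGraph, SimpleGraph.fromRel_adj]
  constructor
  · rintro ⟨-, ⟨e, i, u, h1, h2, h3⟩ | ⟨e, i, u, h1, h2, h3⟩⟩
    · cases h1; cases h2; exact h3
    · cases h1
  · intro h
    exact ⟨by simp, Or.inl ⟨q.1, q.2, v, rfl, rfl, h⟩⟩

/-- The edge of the associated graph joining `v` to the midpoint `q`. -/
def halfEdge (q : Σ e : G.edgeSet, Fin (w e)) {v : V} (hv : v ∈ (q.1 : Sym2 V)) :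
    (assocGraph G w).edgeSet :=
  ⟨s(Sum.inl v, Sum.inr q), assocGraph_adj_inl_inr.2 hv⟩

lemma exists_eq_halfEdge (h : (assocGraph G w).edgeSet) :
    ∃ (q : Σ e : G.edgeSet, Fin (w e)) (v : V) (hv : v ∈ (q.1 : Sym2 V)), h = halfEdge q hv := by
  obtain ⟨z, hz⟩ := h
  induction z with
  | _ x y =>
    have hz' := hz
    rw [SimpleGraph.mem_edgeSet, assocGraph, SimpleGraph.fromRel_adj] at hz'
    obtain ⟨-, ⟨e, i, u, rfl, rfl, h3⟩ | ⟨e, i, u, rfl, rfl, h3⟩⟩ := hz'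
    · exact ⟨⟨e, i⟩, u, h3, rfl⟩
    · exact ⟨⟨e, i⟩, u, h3, Subtype.ext Sym2.eq_swap⟩

lemma halfEdge_inj {q q' : Σ e : G.edgeSet, Fin (w e)} {v v' : V} {hv : v ∈ (q.1 : Sym2 V)}
    {hv' : v' ∈ (q'.1 : Sym2 V)} (h : halfEdge q hv = halfEdge q' hv') : q = q' ∧ v = v' := by
  have := congrArg Subtype.val h
  simp only [halfEdge, Sym2.eq_iff, Sum.inl.injEq, Sum.inr.injEq, reduceCtorEq, and_self,
    or_false] at this
  exact ⟨this.2, this.1⟩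

/-- From a drawing of the associated graph, keep one well-chosen 2-path for each edge. -/
lemma exists_drawing_wcount_le [Finite V] (hw : ∀ e ∈ G.edgeSet, 0 < w e)
    (D' : Drawing (assocGraph G w)) (hD' : D'.CrossSet.Finite) :
    ∃ D : Drawing G, D.CrossSet.Finite ∧ D.wcount w ≤ D'.CrossSet.ncard := by
  classical
  have := Fintype.ofFinite G.edgeSet
  have hxy (q : Σ e : G.edgeSet, Fin (w e)) : ∃ x y : V, (q.1 : Sym2 V) = s(x, y) := by
    induction (q.1 : Sym2 V) with
    | _ x y => exact ⟨x, y, rfl⟩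
  choose x y hxy using hxy
  have hx (q) : x q ∈ (q.1 : Sym2 V) := by simp [hxy q]
  have hy (q) : y q ∈ (q.1 : Sym2 V) := by simp [hxy q]
  have hne (q) : x q ≠ y q := by
    have := q.1.2
    rw [hxy q] at this
    exact G.ne_of_adj this
  have hA (q : Σ e : G.edgeSet, Fin (w e)) : ∃ A ⊆ D'.arcSet (halfEdge q (hx q)) ∪
      D'.arcSet (halfEdge q (hy q)), IsArc A (D'.vert (Sum.inl (x q)))
        (D'.vert (Sum.inl (y q))) := by
    refine IsArc.exists_isArc_subset_union (D'.isArc_arcSet_of_eq rfl)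
      (D'.isArc_arcSet_of_eq Sym2.eq_swap) (fun h => ?_) (fun h => ?_)
    · have := D'.vert_mem_arcSet h
      simp [halfEdge, hne q] at this
    · have := D'.vert_mem_arcSet h
      simp [halfEdge, (hne q).symm] at this
  choose A hAsub hA using hA
  have hhalf (q z) (hz : z ∈ A q) : ∃ v, ∃ hv : v ∈ (q.1 : Sym2 V),
      z ∈ D'.arcSet (halfEdge q hv) := by
    rcases hAsub q hz with h | h
    · exact ⟨_, hx q, h⟩
    · exact ⟨_, hy q, h⟩
  have hinl (q v) (h : D'.vert (Sum.inl v) ∈ A q) : v ∈ (q.1 : Sym2 V) := by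
    obtain ⟨u, hu, h⟩ := hhalf q _ h
    have := D'.vert_mem_arcSet h
    simp only [halfEdge, Sym2.mem_iff, Sum.inl.injEq, reduceCtorEq, or_false] at this
    rwa [this]
  have hinr (q r) (h : D'.vert (Sum.inr r) ∈ A q) : r = q := by
    obtain ⟨u, hu, h⟩ := hhalf q _ h
    have := D'.vert_mem_arcSet h
    simpa [halfEdge] using this
  let B (q q' : Σ e : G.edgeSet, Fin (w e)) : Set Plane :=
    if q.1 = q'.1 then ∅ else (A q ∩ A q') \ range D'.vert
  let T : Set (Plane × (assocGraph G w).edgeSet × (assocGraph G w).edgeSet) :=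
    {t | t.2.1 ≠ t.2.2 ∧ t.1 ∈ D'.interOf t.2.1 ∩ D'.interOf t.2.2}
  have := Fintype.ofFinite (assocGraph G w).edgeSet
  have hTfin : T.Finite := by
    refine (finite_setOf_triples (B := fun h h' => if h = h' then ∅ else
      D'.interOf h ∩ D'.interOf h') fun h h' => ?_).subset ?_
    · split_ifs with hh
      · exact finite_empty
      · exact Drawing.finite_inter_of_crossSet_finite hD' hh
    · rintro ⟨p, h, h'⟩ ⟨h1, h2⟩
      simpa [h1] using h2
  have hsel (q z) : ∃ h, z ∈ A q → ∃ v, ∃ hv : v ∈ (q.1 : Sym2 V), h = halfEdge q hv ∧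
      z ∈ D'.arcSet h := by
    by_cases hz : z ∈ A q
    · obtain ⟨v, hv, h⟩ := hhalf q z hz
      exact ⟨_, fun _ => ⟨v, hv, rfl, h⟩⟩
    · exact ⟨halfEdge q (hx q), fun h => absurd h hz⟩
  choose sel hsel using hsel
  let F (t : Plane × (Σ e : G.edgeSet, Fin (w e)) × (Σ e : G.edgeSet, Fin (w e))) :=
    (t.1, sel t.2.1 t.1, sel t.2.2 t.1)
  let TQ := {t : Plane × (Σ e : G.edgeSet, Fin (w e)) × (Σ e : G.edgeSet, Fin (w e)) |
    t.1 ∈ B t.2.1 t.2.2}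
  have hTQ (t) (ht : t ∈ TQ) : t.2.1.1 ≠ t.2.2.1 ∧ t.1 ∈ A t.2.1 ∧ t.1 ∈ A t.2.2 ∧
      t.1 ∉ range D'.vert := by
    simp only [TQ, B, mem_ofPred_eq] at ht
    split_ifs at ht with h
    · exact ht.elim
    · exact ⟨h, ht.1.1, ht.1.2, ht.2⟩
  have hmaps : MapsTo F TQ T := by
    rintro ⟨z, q, q'⟩ ht
    obtain ⟨h1, h2, h3, h4⟩ := hTQ _ ht
    obtain ⟨v, hv, e1, m1⟩ := hsel q z h2
    obtain ⟨v', hv', e2, m2⟩ := hsel q' z h3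
    refine ⟨?_, ?_⟩
    · intro he
      simp only [F, e1, e2] at he
      exact h1 (congrArg Sigma.fst (halfEdge_inj he).1)
    · simp only [F, Drawing.interOf_eq]
      exact ⟨⟨m1, h4⟩, m2, h4⟩
  have hinj : InjOn F TQ := by
    rintro ⟨z, q, q'⟩ ht ⟨z2, r, r'⟩ ht' he
    simp only [F, Prod.mk.injEq] at he
    obtain ⟨rfl, he1, he2⟩ := he
    obtain ⟨-, h2, h3, -⟩ := hTQ _ ht
    obtain ⟨-, h2', h3', -⟩ := hTQ _ ht'
    obtain ⟨v, hv, e1, -⟩ := hsel q z h2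
    obtain ⟨v', hv', e2, -⟩ := hsel q' z h3
    obtain ⟨u, hu, k1, -⟩ := hsel r z h2'
    obtain ⟨u', hu', k2, -⟩ := hsel r' z h3'
    rw [e1, k1] at he1
    rw [e2, k2] at he2
    rw [(halfEdge_inj he1).1, (halfEdge_inj he2).1]
  have hBfin (q q') : (B q q').Finite := by
    have hf : TQ.Finite := Set.Finite.of_injOn hmaps hinj hTfin
    refine (hf.image Prod.fst).subset fun z hz => ⟨(z, q, q'), hz, rfl⟩
  have hle : ∑ q, ∑ q', (B q q').ncard ≤ 2 * D'.CrossSet.ncard := by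
    rw [Drawing.two_mul_ncard_crossSet hD', ← ncard_setOf_triples hBfin]
    exact Set.ncard_le_ncard_of_injOn F hmaps hinj hTfin
  obtain ⟨c, hc⟩ := exists_choice_sum_le (fun e : G.edgeSet => w e) (fun e => hw e e.2)
    fun q q' => (B q q').ncard
  obtain ⟨D, hDv, hDA⟩ := Drawing.exists_of_isArc (G := G) (vert := fun v => D'.vert (Sum.inl v))
    (fun u v h => Sum.inl_injective (D'.vert_inj h)) (fun e => A ⟨e, c e⟩)
    (fun e => ⟨_, _, hxy ⟨e, c e⟩, hA _⟩) (fun e v h => hinl _ v h)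
  have hsub (e f : G.edgeSet) (hef : e ≠ f) :
      D.interOf e ∩ D.interOf f ⊆ B ⟨e, c e⟩ ⟨f, c f⟩ := by
    rintro z ⟨h1, h2⟩
    rw [Drawing.interOf_eq, hDA, hDv] at h1 h2
    simp only [B, hef, if_false]
    refine ⟨⟨h1.1, h2.1⟩, ?_⟩
    rintro ⟨v | r, rfl⟩
    · exact h1.2 ⟨v, rfl⟩
    · have k := (hinr _ _ h1.1).symm.trans (hinr _ _ h2.1)
      exact hef (congrArg Sigma.fst k)
  have hDfin : D.CrossSet.Finite :=
    Drawing.crossSet_finite fun e f hef => (hBfin _ _).subset (hsub e f hef)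
  refine ⟨D, hDfin, ?_⟩
  have h2 : 2 * D.wcount w ≤ 2 * D'.CrossSet.ncard := by
    rw [Drawing.two_mul_wcount hDfin]
    refine le_trans (Finset.sum_le_sum fun e _ => Finset.sum_le_sum fun f _ => ?_)
      (hc.trans (le_trans (Finset.sum_le_sum fun q _ => Finset.sum_le_sum fun q' _ => ?_) hle))
    · split_ifs with hef
      · exact le_rfl
      · exact Nat.mul_le_mul_left _ (Set.ncard_le_ncard (hsub e f hef) (hBfin _ _))
    · split_ifs
      · exact Nat.zero_le _
      · exact le_rfl
  omega

end AssociatedGraph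

section Corridors

open Filter Topology

variable {ι : Type*}

/-- A family of simple arcs, with all common points and endpoints in the finite set `S`. -/
structure ArcSystem (γ : ι → ℝ → Plane) (S : Set Plane) : Prop where
  cont : ∀ e, Continuous (γ e)
  injOn : ∀ e, InjOn (γ e) (Icc 0 1)
  finite : S.Finite
  start_mem : ∀ e, γ e 0 ∈ S
  end_mem : ∀ e, γ e 1 ∈ S
  common : ∀ e f, e ≠ f → ∀ s ∈ Icc (0 : ℝ) 1, ∀ t ∈ Icc (0 : ℝ) 1, γ e s = γ f t → γ e s ∈ S

/-- The point `p` is one of the marked points on the arc of `e`. -/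
def Meets (γ : ι → ℝ → Plane) (S : Set Plane) (e : ι) (p : Plane) : Prop :=
  p ∈ S ∧ p ∈ γ e '' Icc 0 1

/-- Discs around the marked points, of squared radius `ρ`, that are disjoint and cut the arcs
only close (in time, up to `η`) to the marked points in question. -/
structure SmallRadius (γ : ι → ℝ → Plane) (S : Set Plane) (η ρ : ℝ) : Prop where
  pos : 0 < ρ
  eta_pos : 0 < η
  apart : ∀ e, ∀ s ∈ Icc (0 : ℝ) 1, ∀ t ∈ Icc (0 : ℝ) 1, γ e s ∈ S → γ e t ∈ S → s ≠ t →
    2 * η ≤ |s - t|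
  near : ∀ e, ∀ p ∈ S, ∀ s ∈ Icc (0 : ℝ) 1, sqDist p (γ e s) ≤ ρ →
    ∃ t ∈ Icc (0 : ℝ) 1, γ e t = p ∧ |s - t| < η
  disc : ∀ p ∈ S, ∀ q ∈ S, ∀ z, sqDist p z ≤ ρ → sqDist q z ≤ ρ → p = q

lemma ArcSystem.exists_smallRadius [Finite ι] {γ : ι → ℝ → Plane} {S : Set Plane}
    (h : ArcSystem γ S) : ∃ η ρ : ℝ, SmallRadius γ S η ρ := by
  have hfin : ∀ e, {s ∈ Icc (0 : ℝ) 1 | γ e s ∈ S}.Finite := fun e =>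
    Set.Finite.of_finite_image (h.finite.subset <| image_subset_iff.2 fun s hs => hs.2)
      ((h.injOn e).mono fun s hs => hs.1)
  have h1 : ∀ᶠ η in 𝓝[>] (0 : ℝ), ∀ e, ∀ s ∈ {s ∈ Icc (0 : ℝ) 1 | γ e s ∈ S},
      ∀ t ∈ {s ∈ Icc (0 : ℝ) 1 | γ e s ∈ S}, s ≠ t → 2 * η ≤ |s - t| := by
    rw [eventually_all]; intro e
    rw [eventually_all_finite (hfin e)]; intro s _
    rw [eventually_all_finite (hfin e)]; intro t _
    by_cases hst : s = t
    · simp [hst]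
    have h0 : 0 < |s - t| / 2 := by have := abs_pos.2 (sub_ne_zero.2 hst); linarith
    filter_upwards [Ioo_mem_nhdsGT h0] with η hη _
    linarith [hη.2]
  obtain ⟨η, h1, hη⟩ := (h1.and self_mem_nhdsWithin).exists
  have hη : 0 < η := hη
  have h2 : ∀ᶠ ρ in 𝓝[>] (0 : ℝ), ∀ e, ∀ p ∈ S, ∀ s ∈ Icc (0 : ℝ) 1, sqDist p (γ e s) ≤ ρ →
      ∃ t ∈ Icc (0 : ℝ) 1, γ e t = p ∧ |s - t| < η := by
    rw [eventually_all]; intro e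
    rw [eventually_all_finite h.finite]; intro p _
    set K : Set ℝ := Icc 0 1 ∩ ⋂ t ∈ {t | t ∈ Icc (0 : ℝ) 1 ∧ γ e t = p}, {s | η ≤ |s - t|}
    have hK : IsCompact K := isCompact_Icc.inter_right <| isClosed_biInter fun t _ =>
      isClosed_le continuous_const (by fun_prop)
    have hc : Continuous fun s => sqDist p (γ e s) :=
      continuous_sqDist continuous_const (h.cont e)
    obtain ⟨ρ, hρ, hρK⟩ := hK.exists_forall_le' hc.continuousOn (a := 0) (by
      rintro s ⟨hs, hs'⟩
      apply sqDist_pos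
      rintro rfl
      have := mem_iInter₂.1 hs' s ⟨hs, rfl⟩
      simp at this; linarith)
    filter_upwards [Ioo_mem_nhdsGT hρ] with r hr s hs hsr
    by_contra! hcon
    have := hρK s ⟨hs, mem_iInter₂.2 fun t ht => hcon t ht.1 ht.2⟩
    linarith [hr.2]
  have h3 : ∀ᶠ ρ in 𝓝[>] (0 : ℝ), ∀ p ∈ S, ∀ q ∈ S, p ≠ q → 4 * ρ < sqDist p q := by
    rw [eventually_all_finite h.finite]; intro p _
    rw [eventually_all_finite h.finite]; intro q _
    by_cases hpq : p = q
    · simp [hpq]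
    have h0 : 0 < sqDist p q / 4 := by have := sqDist_pos hpq; linarith
    filter_upwards [Ioo_mem_nhdsGT h0] with η hη _
    linarith [hη.2]
  obtain ⟨ρ, ⟨h2, h3⟩, hρ⟩ := ((h2.and h3).and self_mem_nhdsWithin).exists
  refine ⟨η, ρ, hρ, hη, fun e s hs t ht hs' ht' hst => h1 e s ⟨hs, hs'⟩ t ⟨ht, ht'⟩ hst, h2, ?_⟩
  intro p hp q hq z hpz hqz
  by_contra hpq
  linarith [h3 p hp q hq hpq, sqDist_triangle p q z]

/-- The times `m ≤ t ≤ q` at which the arc `c` first meets the disc of squared radius `ρ` around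
`p`, passes through `p`, and leaves the disc forever. -/
structure Passage (c : ℝ → Plane) (p : Plane) (η ρ m t q : ℝ) : Prop where
  mem : t ∈ Icc (0 : ℝ) 1
  eq : c t = p
  mem_left : m ∈ Icc (0 : ℝ) 1
  mem_right : q ∈ Icc (0 : ℝ) 1
  left_le : m ≤ t
  le_right : t ≤ q
  left_near : t - m < η
  right_near : q - t < η
  disc_left : sqDist p (c m) ≤ ρ
  disc_right : sqDist p (c q) ≤ ρ
  bound : ∀ s ∈ Icc (0 : ℝ) 1, sqDist p (c s) ≤ ρ → s ∈ Icc m q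
  left_eq : t ≠ 0 → sqDist p (c m) = ρ
  right_eq : t ≠ 1 → sqDist p (c q) = ρ

lemma ArcSystem.exists_passage {γ : ι → ℝ → Plane} {S : Set Plane} {η ρ : ℝ}
    (h : ArcSystem γ S) (hr : SmallRadius γ S η ρ) {e : ι} {p : Plane} (hp : Meets γ S e p) :
    ∃ m t q : ℝ, Passage (γ e) p η ρ m t q := by
  obtain ⟨hpS, t, ht, rfl⟩ := hp
  have hc : Continuous fun s => sqDist (γ e t) (γ e s) :=
    continuous_sqDist continuous_const (h.cont e)
  have hT : IsCompact (Icc (0 : ℝ) 1 ∩ {s | sqDist (γ e t) (γ e s) ≤ ρ}) :=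
    isCompact_Icc.inter_right (isClosed_le hc continuous_const)
  have htT : t ∈ Icc (0 : ℝ) 1 ∩ {s | sqDist (γ e t) (γ e s) ≤ ρ} :=
    ⟨ht, by simpa [sqDist_self] using hr.pos.le⟩
  obtain ⟨m, ⟨hm, hmρ⟩, hmin⟩ := hT.exists_isLeast ⟨t, htT⟩
  obtain ⟨q, ⟨hq, hqρ⟩, hmax⟩ := hT.exists_isGreatest ⟨t, htT⟩
  have near : ∀ s ∈ Icc (0 : ℝ) 1, sqDist (γ e t) (γ e s) ≤ ρ → |s - t| < η := by
    intro s hs hsρ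
    obtain ⟨t', ht', heq, hlt⟩ := hr.near e _ hpS s hs hsρ
    rwa [h.injOn e ht' ht heq] at hlt
  have hmt := hmin htT
  have htq := hmax htT
  refine ⟨m, t, q, ht, rfl, hm, hq, hmt, htq, ?_, ?_, hmρ, hqρ,
    fun s hs hsρ => ⟨hmin ⟨hs, hsρ⟩, hmax ⟨hs, hsρ⟩⟩, fun ht0 => ?_, fun ht1 => ?_⟩
  · linarith [(abs_lt.1 (near m hm hmρ)).1]
  · linarith [(abs_lt.1 (near q hq hqρ)).2]
  · by_contra hne
    have hlt : sqDist (γ e t) (γ e m) < ρ := lt_of_le_of_ne hmρ hne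
    rcases hm.1.eq_or_lt with h0 | h0
    · have h1 := hr.apart e t ht 0 (by simp) hpS (h.start_mem e) ht0
      have h2 := near m hm hmρ
      rw [← h0, abs_sub_comm] at h2
      linarith [abs_nonneg (t - 0), hr.eta_pos]
    · have hev : ∀ᶠ s in 𝓝[<] m, sqDist (γ e t) (γ e s) < ρ ∧ s ∈ Ioo 0 m :=
        ((hc.tendsto m).eventually_lt_const hlt |>.filter_mono nhdsWithin_le_nhds).and
          (Ioo_mem_nhdsLT h0)
      obtain ⟨s, hs, hs0, hsm⟩ := hev.exists
      exact absurd (hmin ⟨⟨hs0.le, hsm.le.trans hm.2⟩, hs.le⟩) (not_le.2 hsm)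
  · by_contra hne
    have hlt : sqDist (γ e t) (γ e q) < ρ := lt_of_le_of_ne hqρ hne
    rcases hq.2.eq_or_lt with h0 | h0
    · have h1 := hr.apart e t ht 1 (by simp) hpS (h.end_mem e) ht1
      have h2 := near q hq hqρ
      rw [h0, abs_sub_comm] at h2
      linarith [abs_nonneg (t - 1), hr.eta_pos]
    · have hev : ∀ᶠ s in 𝓝[>] q, sqDist (γ e t) (γ e s) < ρ ∧ s ∈ Ioo q 1 :=
        ((hc.tendsto q).eventually_lt_const hlt |>.filter_mono nhdsWithin_le_nhds).and
          (Ioo_mem_nhdsGT h0)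
      obtain ⟨s, hs, hs0, hsm⟩ := hev.exists
      exact absurd (hmax ⟨⟨hq.1.trans hs0.le, hsm.le⟩, hs.le⟩) (not_le.2 hs0)

end Corridors

section CorridorConstruction

open Filter Topology

variable {ι : Type*}

/-- Two points that are joined by a polygonal chain in `R`. -/
def PolyConn (R : Set Plane) : Plane → Plane → Prop :=
  Relation.ReflTransGen fun x y => segment ℝ x y ⊆ R

lemma PolyConn.symm {R : Set Plane} {x y : Plane} (h : PolyConn R x y) : PolyConn R y x := by
  induction h with
  | refl => exact .refl
  | tail _ h ih => exact .head (by rwa [segment_symm]) ih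

lemma PolyConn.exists_chain {R : Set Plane} {x y : Plane} (h : PolyConn R x y) :
    ∃ (k : ℕ) (P : ℕ → Plane), P 0 = x ∧ P k = y ∧ ∀ m < k, segment ℝ (P m) (P (m + 1)) ⊆ R := by
  induction h using Relation.ReflTransGen.head_induction_on with
  | refl => exact ⟨0, fun _ => y, rfl, rfl, by simp⟩
  | @head a c h _ ih =>
    obtain ⟨k, P, h0, hk, hP⟩ := ih
    refine ⟨k + 1, fun m => m.casesOn a P, rfl, hk, fun m hm => ?_⟩
    cases m with
    | zero => simpa [h0] using h
    | succ m => exact hP m (by omega)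

/-- Open corridors `U e` around the parts of the arcs outside small discs around the marked
points, together with the chords `[a e p, b e p]` joining them inside the discs. -/
structure Corridors (γ : ι → ℝ → Plane) (S : Set Plane) (ρ : ℝ) (a b : ι → Plane → Plane)
    (U : ι → Set Plane) : Prop where
  pos : 0 < ρ
  isOpen : ∀ e, IsOpen (U e)
  notMem : ∀ e, ∀ p ∈ S, p ∉ closure (U e)
  disjoint_chord : ∀ e f p, e ≠ f → Meets γ S f p →
    Disjoint (closure (U e)) (segment ℝ (a f p) (b f p))
  disjoint : ∀ e f, e ≠ f → Disjoint (U e) (U f)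
  chord_disjoint : ∀ e f p q, p ≠ q → Meets γ S e p → Meets γ S f q →
    Disjoint (segment ℝ (a e p) (b e p)) (segment ℝ (a f q) (b f q))
  eq_of_mem_chord : ∀ e p q, Meets γ S e p → q ∈ S → q ∈ segment ℝ (a e p) (b e p) → q = p
  circle_left : ∀ e p, Meets γ S e p → p ≠ γ e 0 → sqDist p (a e p) = ρ
  circle_right : ∀ e p, Meets γ S e p → p ≠ γ e 1 → sqDist p (b e p) = ρ
  ne : ∀ e p, Meets γ S e p → a e p ≠ b e p
  left_start : ∀ e, a e (γ e 0) = γ e 0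
  right_end : ∀ e, b e (γ e 1) = γ e 1
  distinct : ∀ e f p, e ≠ f → Meets γ S e p → Meets γ S f p →
    ∀ c, (c = a e p ∨ c = b e p) → (c = a f p ∨ c = b f p) → c = p
  conn : ∀ e, PolyConn (U e ∪ ⋃ p ∈ {p | Meets γ S e p}, segment ℝ (a e p) (b e p))
    (γ e 0) (γ e 1)

/-- The times at which the arc `γ e` is outside the open discs around the marked points and
outside the time intervals spent near the marked points. -/
def outerTimes (γ : ι → ℝ → Plane) (S : Set Plane) (ρ : ℝ) (m q : ι → Plane → ℝ) (e : ι) :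
    Set ℝ :=
  Icc 0 1 ∩ ⋂ p ∈ S, {s | ρ ≤ sqDist p (γ e s) ∧ (Meets γ S e p → s ∉ Ioo (m e p) (q e p))}

lemma mem_outerTimes {γ : ι → ℝ → Plane} {S : Set Plane} {ρ : ℝ} {m q : ι → Plane → ℝ} {e : ι}
    {s : ℝ} : s ∈ outerTimes γ S ρ m q e ↔ s ∈ Icc (0 : ℝ) 1 ∧ ∀ p ∈ S, ρ ≤ sqDist p (γ e s) ∧
      (Meets γ S e p → s ∉ Ioo (m e p) (q e p)) := by
  simp [outerTimes]

lemma ArcSystem.isCompact_outerTimes {γ : ι → ℝ → Plane} {S : Set Plane} (h : ArcSystem γ S)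
    (ρ : ℝ) (m q : ι → Plane → ℝ) (e : ι) : IsCompact (outerTimes γ S ρ m q e) := by
  refine isCompact_Icc.inter_right (isClosed_biInter fun p _ => ?_)
  refine (isClosed_le continuous_const (continuous_sqDist continuous_const (h.cont e))).inter ?_
  change IsClosed {s | Meets γ S e p → s ∉ Ioo (m e p) (q e p)}
  by_cases hp : Meets γ S e p
  · simp only [hp, true_imp_iff]
    exact isOpen_Ioo.isClosed_compl
  · simp [hp]

/-- Passing along an arc in small steps, replacing passages near the marked points by chords. -/
lemma ArcSystem.polyConn {γ : ι → ℝ → Plane} {S : Set Plane} {η ρ : ℝ}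
    (h : ArcSystem γ S) (hr : SmallRadius γ S η ρ) {m t q : ι → Plane → ℝ}
    (hm : ∀ e p, Meets γ S e p → Passage (γ e) p η ρ (m e p) (t e p) (q e p)) (e : ι)
    {U : Set Plane} (hU : IsOpen U) (hsub : γ e '' outerTimes γ S ρ m q e ⊆ U) :
    PolyConn (U ∪ ⋃ p ∈ {p | Meets γ S e p}, segment ℝ (γ e (m e p)) (γ e (q e p)))
      (γ e 0) (γ e 1) := by
  classical
  set R := U ∪ ⋃ p ∈ {p | Meets γ S e p}, segment ℝ (γ e (m e p)) (γ e (q e p))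
  have chord : ∀ p, Meets γ S e p → PolyConn R (γ e (m e p)) (γ e (q e p)) := fun p hp =>
    .single <| subset_union_of_subset_right (subset_biUnion_of_mem (u := fun p =>
      segment ℝ (γ e (m e p)) (γ e (q e p))) hp) _
  have uniq : ∀ p p' s, Meets γ S e p → Meets γ S e p' → s ∈ Icc (m e p) (q e p) →
      s ∈ Icc (m e p') (q e p') → p = p' := by
    intro p p' s hp hp' hs hs'
    by_contra hne
    have h1 := hm e p hp
    have h2 := hm e p' hp'
    have h3 := hr.apart e _ h1.mem _ h2.mem (by rw [h1.eq]; exact hp.1) (by rw [h2.eq]; exact hp'.1)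
      (fun heq => hne (by rw [← h1.eq, ← h2.eq, heq]))
    have : |t e p - t e p'| < 2 * η := by
      rw [abs_lt]
      constructor <;> linarith [h1.left_near, h2.left_near, h1.right_near, h2.right_near,
        hs.1, hs.2, hs'.1, hs'.2]
    linarith
  set pt : ℝ → Plane := fun s =>
    if hs : ∃ p, Meets γ S e p ∧ s ∈ Icc (m e p) (q e p) then γ e (m e hs.choose) else γ e s
  have pt_in : ∀ p s, Meets γ S e p → s ∈ Icc (m e p) (q e p) → pt s = γ e (m e p) := by
    intro p s hp hs
    have hex : ∃ p, Meets γ S e p ∧ s ∈ Icc (m e p) (q e p) := ⟨p, hp, hs⟩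
    simp only [pt, dif_pos hex]
    rw [uniq _ _ s hex.choose_spec.1 hp hex.choose_spec.2 hs]
  have pt_out : ∀ s, (∀ p, Meets γ S e p → s ∉ Icc (m e p) (q e p)) → pt s = γ e s := by
    intro s hs
    simp only [pt]
    rw [dif_neg]
    rintro ⟨p, hp, hp'⟩
    exact hs p hp hp'
  have pt_outer : ∀ s ∈ outerTimes γ S ρ m q e, PolyConn R (pt s) (γ e s) := by
    intro s hs
    rw [mem_outerTimes] at hs
    by_cases hex : ∃ p, Meets γ S e p ∧ s ∈ Icc (m e p) (q e p)
    · obtain ⟨p, hp, hsp⟩ := hex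
      rw [pt_in p s hp hsp]
      have := (hs.2 p hp.1).2 hp
      rcases hsp.1.eq_or_lt with h1 | h1
      · rw [h1]; exact .refl
      rcases hsp.2.eq_or_lt with h2 | h2
      · rw [h2]; exact chord p hp
      exact absurd ⟨h1, h2⟩ this
    · rw [pt_out s fun p hp hp' => hex ⟨p, hp, hp'⟩]
      exact .refl
  have loc : ∀ s ∈ Icc (0 : ℝ) 1, ∀ᶠ s' in 𝓝[Icc 0 1] s, PolyConn R (pt s) (pt s') := by
    intro s hs
    by_cases hJ : s ∈ outerTimes γ S ρ m q e
    · have hsU : U ∈ 𝓝 (γ e s) := hU.mem_nhds (hsub ⟨s, hJ, rfl⟩)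
      obtain ⟨r, hr0, hball⟩ := Metric.mem_nhds_iff.1 hsU
      have h1 : ∀ᶠ s' in 𝓝[Icc 0 1] s, γ e s' ∈ Metric.ball (γ e s) r :=
        ((h.cont e).tendsto s).eventually (Metric.ball_mem_nhds _ hr0)
          |>.filter_mono nhdsWithin_le_nhds
      have h2 : ∀ᶠ s' in 𝓝[Icc 0 1] s, ∀ p ∈ {p | Meets γ S e p}, s ∉ Icc (m e p) (q e p) →
          s' ∉ Icc (m e p) (q e p) := by
        refine Filter.Eventually.filter_mono nhdsWithin_le_nhds ?_
        rw [eventually_all_finite (h.finite.subset fun p hp => hp.1)]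
        intro p _
        by_cases hsp : s ∈ Icc (m e p) (q e p)
        · simp [hsp]
        · filter_upwards [isClosed_Icc.isOpen_compl.mem_nhds hsp] with s' hs' _ using hs'
      filter_upwards [h1, h2] with s' h1 h2
      by_cases hex : ∃ p, Meets γ S e p ∧ s' ∈ Icc (m e p) (q e p)
      · obtain ⟨p, hp, hsp⟩ := hex
        have : s ∈ Icc (m e p) (q e p) := by
          by_contra hcon
          exact h2 p hp hcon hsp
        rw [pt_in p s hp this, pt_in p s' hp hsp]
        exact .refl
      · rw [pt_out s' fun p hp hp' => hex ⟨p, hp, hp'⟩]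
        refine (pt_outer s hJ).tail (Set.Subset.trans ?_ subset_union_left)
        exact ((convex_ball _ _).segment_subset (Metric.mem_ball_self hr0) h1).trans hball
    · obtain ⟨p, hp, hev⟩ : ∃ p, Meets γ S e p ∧
          ∀ᶠ s' in 𝓝[Icc 0 1] s, s' ∈ Icc (m e p) (q e p) := by
        rw [mem_outerTimes] at hJ
        push Not at hJ
        obtain ⟨p, hp, hpJ⟩ := hJ hs
        by_cases hlt : sqDist p (γ e s) < ρ
        · obtain ⟨t', ht', heq, -⟩ := hr.near e p hp s hs hlt.le
          have hM : Meets γ S e p := ⟨hp, t', ht', heq⟩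
          refine ⟨p, hM, ?_⟩
          have hc : Continuous fun s => sqDist p (γ e s) :=
            continuous_sqDist continuous_const (h.cont e)
          filter_upwards [self_mem_nhdsWithin,
            ((hc.tendsto s).eventually_lt_const hlt).filter_mono nhdsWithin_le_nhds] with s' h1 h2
          exact (hm e p hM).bound s' h1 h2.le
        · obtain ⟨hM, hIoo⟩ := hpJ (not_lt.1 hlt)
          refine ⟨p, hM, Filter.Eventually.filter_mono nhdsWithin_le_nhds ?_⟩
          filter_upwards [Ioo_mem_nhds hIoo.1 hIoo.2] with s' hs' using ⟨hs'.1.le, hs'.2.le⟩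
      filter_upwards [hev] with s' hs'
      rw [pt_in p s hp (mem_of_mem_nhdsWithin hs hev), pt_in p s' hp hs']
      exact .refl
  have key : PolyConn R (pt 0) (pt 1) :=
    isPreconnected_Icc.induction₂ (fun s s' => PolyConn R (pt s) (pt s')) loc
      (fun _ _ _ _ _ _ h1 h2 => h1.trans h2) (fun _ _ _ _ h => h.symm)
      (left_mem_Icc.2 zero_le_one) (right_mem_Icc.2 zero_le_one)
  have hM0 : Meets γ S e (γ e 0) := ⟨h.start_mem e, 0, by simp, rfl⟩
  have hM1 : Meets γ S e (γ e 1) := ⟨h.end_mem e, 1, by simp, rfl⟩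
  have p0 := hm e _ hM0
  have p1 := hm e _ hM1
  have t0 : t e (γ e 0) = 0 := h.injOn e p0.mem (by simp) p0.eq
  have t1 : t e (γ e 1) = 1 := h.injOn e p1.mem (by simp) p1.eq
  have m0 : m e (γ e 0) = 0 := le_antisymm (p0.left_le.trans t0.le) p0.mem_left.1
  have q1 : q e (γ e 1) = 1 := le_antisymm p1.mem_right.2 (t1.ge.trans p1.le_right)
  have e0 : pt 0 = γ e 0 := by
    rw [pt_in _ 0 hM0 ⟨m0.le, p0.mem_right.1⟩, m0]
  have e1 : PolyConn R (pt 1) (γ e 1) := by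
    rw [pt_in _ 1 hM1 ⟨p1.mem_left.2, q1.ge⟩]
    have := chord _ hM1
    rwa [q1] at this
  rw [e0] at key
  exact key.trans e1

theorem ArcSystem.exists_corridors [Finite ι] {γ : ι → ℝ → Plane} {S : Set Plane}
    (h : ArcSystem γ S) : ∃ ρ a b U, Corridors γ S ρ a b U := by
  classical
  obtain ⟨η, ρ, hr⟩ := h.exists_smallRadius
  have hex : ∀ e p, ∃ m t q : ℝ, Meets γ S e p → Passage (γ e) p η ρ m t q := by
    intro e p
    by_cases hp : Meets γ S e p
    · obtain ⟨m, t, q, hP⟩ := h.exists_passage hr hp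
      exact ⟨m, t, q, fun _ => hP⟩
    · exact ⟨0, 0, 0, fun hp' => absurd hp' hp⟩
  choose m t q hm using hex
  set C : ι → Set Plane := fun e => γ e '' outerTimes γ S ρ m q e with hC
  have C_compact : ∀ e, IsCompact (C e) := fun e =>
    (h.isCompact_outerTimes ρ m q e).image (h.cont e)
  have C_notMem : ∀ e, ∀ p ∈ S, p ∉ C e := by
    rintro e p hp ⟨s, hs, rfl⟩
    have := ((mem_outerTimes.1 hs).2 _ hp).1
    rw [sqDist_self] at this
    linarith [hr.pos]
  have C_disjoint : ∀ e f, e ≠ f → Disjoint (C e) (C f) := by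
    intro e f hef
    rw [Set.disjoint_left]
    rintro _ ⟨s, hs, rfl⟩ ⟨s', hs', heq⟩
    exact C_notMem e _ (h.common e f hef s (mem_outerTimes.1 hs).1 s' (mem_outerTimes.1 hs').1
      heq.symm) ⟨s, hs, rfl⟩
  have C_disc : ∀ e, ∀ z ∈ C e, ∀ p ∈ S, sqDist p z ≤ ρ → sqDist p z = ρ ∧
      (z = γ e (m e p) ∨ z = γ e (q e p)) := by
    rintro e _ ⟨s, hs, rfl⟩ p hp hle
    rw [mem_outerTimes] at hs
    obtain ⟨t', ht', heq, -⟩ := hr.near e p hp s hs.1 hle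
    have hM : Meets γ S e p := ⟨hp, t', ht', heq⟩
    have hJ := hs.2 p hp
    refine ⟨le_antisymm hle hJ.1, ?_⟩
    have hb := (hm e p hM).bound s hs.1 hle
    rcases hb.1.eq_or_lt with h1 | h1
    · exact Or.inl (by rw [h1])
    rcases hb.2.eq_or_lt with h2 | h2
    · exact Or.inr (by rw [h2])
    exact absurd ⟨h1, h2⟩ (hJ.2 hM)
  have mem_arc : ∀ e p c, Meets γ S e p → (c = γ e (m e p) ∨ c = γ e (q e p)) →
      (∃ s ∈ Icc (0 : ℝ) 1, γ e s = c) ∧ sqDist p c ≤ ρ := by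
    rintro e p c hp (rfl | rfl)
    · exact ⟨⟨_, (hm e p hp).mem_left, rfl⟩, (hm e p hp).disc_left⟩
    · exact ⟨⟨_, (hm e p hp).mem_right, rfl⟩, (hm e p hp).disc_right⟩
  have chord_disc : ∀ e p z, Meets γ S e p → z ∈ segment ℝ (γ e (m e p)) (γ e (q e p)) →
      sqDist p z ≤ ρ := fun e p z hp hz =>
    sqDist_le_of_mem_segment (hm e p hp).disc_left (hm e p hp).disc_right hz
  have C_chord : ∀ e f p, e ≠ f → Meets γ S f p →
      Disjoint (C e) (segment ℝ (γ f (m f p)) (γ f (q f p))) := by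
    intro e f p hef hp
    rw [Set.disjoint_left]
    intro z hz hz'
    have hle := chord_disc f p z hp hz'
    obtain ⟨heq, -⟩ := C_disc e z hz p hp.1 hle
    obtain ⟨⟨s', hs', hs'z⟩, -⟩ := mem_arc f p z hp <|
      eq_or_eq_of_mem_segment_of_sqDist (hm f p hp).disc_left (hm f p hp).disc_right hz' heq
    obtain ⟨s, hs, rfl⟩ := hz
    exact C_notMem e _ (h.common e f hef s (mem_outerTimes.1 hs).1 s' hs' hs'z.symm) ⟨s, hs, rfl⟩
  set F : ι → Set Plane := fun e => S ∪ ⋃ f ∈ {f | e ≠ f}, (C f ∪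
    ⋃ p ∈ {p | Meets γ S f p}, segment ℝ (γ f (m f p)) (γ f (q f p))) with hF
  have hMfin : ∀ f, {p | Meets γ S f p}.Finite := fun f => h.finite.subset fun p hp => hp.1
  have F_closed : ∀ e, IsClosed (F e) := fun e =>
    h.finite.isClosed.union <| (Set.toFinite _).isClosed_biUnion fun f _ =>
      (C_compact f).isClosed.union <| (hMfin f).isClosed_biUnion fun p _ =>
        (isCompact_segment _ _).isClosed
  have C_F : ∀ e, Disjoint (C e) (F e) := by
    intro e
    simp only [hF, disjoint_union_right, disjoint_iUnion_right]
    exact ⟨Set.disjoint_right.2 fun p hp => C_notMem e p hp, fun f hef =>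
      ⟨C_disjoint e f hef, fun p hp => C_chord e f p hef hp⟩⟩
  choose δ hδ0 hδ using fun e => (C_F e).exists_cthickenings (C_compact e) (F_closed e)
  have clos : ∀ e, closure (Metric.thickening (δ e) (C e)) ⊆ Metric.cthickening (δ e) (C e) :=
    fun e => Metric.closure_thickening_subset_cthickening _ _
  have clos_F : ∀ e, Disjoint (closure (Metric.thickening (δ e) (C e))) (F e) := fun e =>
    (hδ e).mono (clos e) (Metric.self_subset_cthickening _)
  have U_disjoint : ∀ e f, e ≠ f → δ f ≤ δ e →
      Disjoint (Metric.thickening (δ e) (C e)) (Metric.thickening (δ f) (C f)) := by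
    intro e f hef hle
    refine (hδ e).mono (Metric.thickening_subset_cthickening _ _) ?_
    refine (Metric.thickening_subset_cthickening_of_le hle _).trans
      (Metric.cthickening_subset_of_subset _ ?_)
    exact subset_union_of_subset_right (subset_biUnion_of_mem (u := fun f => C f ∪
      ⋃ p ∈ {p | Meets γ S f p}, segment ℝ (γ f (m f p)) (γ f (q f p))) hef
        |>.trans' subset_union_left) _
  have hM0 : ∀ e, Meets γ S e (γ e 0) := fun e => ⟨h.start_mem e, 0, by simp, rfl⟩
  have hM1 : ∀ e, Meets γ S e (γ e 1) := fun e => ⟨h.end_mem e, 1, by simp, rfl⟩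
  have left_eq : ∀ e p, Meets γ S e p → p ≠ γ e 0 → sqDist p (γ e (m e p)) = ρ := by
    intro e p hp hne
    refine (hm e p hp).left_eq fun h0 => hne ?_
    rw [← h0, (hm e p hp).eq]
  have right_eq : ∀ e p, Meets γ S e p → p ≠ γ e 1 → sqDist p (γ e (q e p)) = ρ := by
    intro e p hp hne
    refine (hm e p hp).right_eq fun h0 => hne ?_
    rw [← h0, (hm e p hp).eq]
  have ends_ne : ∀ e, γ e 0 ≠ γ e 1 := fun e h01 =>
    zero_ne_one (h.injOn e (by simp) (by simp) h01)
  refine ⟨ρ, fun e p => γ e (m e p), fun e p => γ e (q e p),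
    fun e => Metric.thickening (δ e) (C e), ⟨hr.pos, fun e => Metric.isOpen_thickening, ?_, ?_, ?_,
    ?_, ?_, left_eq, right_eq, ?_, ?_, ?_, ?_, ?_⟩⟩
  · exact fun e p hp hp' => Set.disjoint_left.1 (clos_F e) hp' (Or.inl hp)
  · intro e f p hef hp
    refine (clos_F e).mono_right (subset_union_of_subset_right ?_ _)
    refine Set.Subset.trans ?_ (subset_biUnion_of_mem (u := fun f => C f ∪
      ⋃ p ∈ {p | Meets γ S f p}, segment ℝ (γ f (m f p)) (γ f (q f p))) hef)
    exact subset_union_of_subset_right (subset_biUnion_of_mem (u := fun p =>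
      segment ℝ (γ f (m f p)) (γ f (q f p))) hp) _
  · intro e f hef
    rcases le_total (δ f) (δ e) with hle | hle
    · exact U_disjoint e f hef hle
    · exact (U_disjoint f e hef.symm hle).symm
  · intro e f p p' hpp hp hp'
    rw [Set.disjoint_left]
    intro z hz hz'
    exact hpp (hr.disc p hp.1 p' hp'.1 z (chord_disc e p z hp hz) (chord_disc f p' z hp' hz'))
  · intro e p p' hp hp' hz
    exact hr.disc p' hp' p hp.1 p' (by rw [sqDist_self]; exact hr.pos.le) (chord_disc e p p' hp hz)
  · intro e p hp heq
    have hP := hm e p hp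
    have hmq := h.injOn e hP.mem_left hP.mem_right heq
    have h1 : m e p = t e p := le_antisymm hP.left_le (hmq ▸ hP.le_right)
    have h2 : γ e (m e p) = p := by rw [h1, hP.eq]
    have h3 : γ e (q e p) = p := by rw [← hmq, h2]
    by_cases h0 : p = γ e 0
    · have := right_eq e p hp (by rw [h0]; exact ends_ne e)
      rw [h3, sqDist_self] at this
      exact hr.pos.ne this
    · have := left_eq e p hp h0
      rw [h2, sqDist_self] at this
      exact hr.pos.ne this
  · intro e
    have p0 := hm e _ (hM0 e)
    have t0 : t e (γ e 0) = 0 := h.injOn e p0.mem (by simp) p0.eq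
    have m0 : m e (γ e 0) = 0 := le_antisymm (p0.left_le.trans t0.le) p0.mem_left.1
    simp only [m0]
  · intro e
    have p1 := hm e _ (hM1 e)
    have t1 : t e (γ e 1) = 1 := h.injOn e p1.mem (by simp) p1.eq
    have q1 : q e (γ e 1) = 1 := le_antisymm p1.mem_right.2 (t1.ge.trans p1.le_right)
    simp only [q1]
  · intro e f p hef hp hp' c hc hc'
    obtain ⟨⟨s, hs, rfl⟩, hle⟩ := mem_arc e p c hp hc
    obtain ⟨⟨s', hs', heq⟩, -⟩ := mem_arc f p _ hp' hc'
    have hS := h.common e f hef s hs s' hs' heq.symm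
    exact hr.disc _ hS p hp.1 _ (by rw [sqDist_self]; exact hr.pos.le) hle
  · exact fun e => h.polyConn hr hm e Metric.isOpen_thickening
      (Metric.self_subset_thickening (hδ0 e) _)

end CorridorConstruction

section MinimalChains

/-- `x` and `y` are joined by a polygonal chain in `R` with `k` segments. -/
def Reach (R : Set Plane) (k : ℕ) (x y : Plane) : Prop :=
  ∃ P : ℕ → Plane, P 0 = x ∧ P k = y ∧ ∀ m < k, segment ℝ (P m) (P (m + 1)) ⊆ R

lemma Reach.trans {R : Set Plane} {k l : ℕ} {x y z : Plane} (h : Reach R k x y)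
    (h' : Reach R l y z) : Reach R (k + l) x z := by
  obtain ⟨P, rfl, hk, hP⟩ := h
  obtain ⟨Q, hQ0, rfl, hQ⟩ := h'
  refine ⟨fun j => if j ≤ k then P j else Q (j - k), by simp, ?_, fun m hm => ?_⟩
  · rcases Nat.eq_zero_or_pos l with rfl | hl
    · simp [hk, hQ0]
    · simp [hl.ne']
  · rcases lt_trichotomy m k with h | rfl | h
    · simpa [h.le, Nat.succ_le_of_lt h] using hP m h
    · simpa [hk, ← hQ0] using hQ 0 (by omega)
    · have := hQ (m - k) (by omega)
      simpa [h.not_ge, show ¬ m + 1 ≤ k by omega, show m - k + 1 = m + 1 - k by omega] using this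

lemma Reach.single {R : Set Plane} {x y : Plane} (h : segment ℝ x y ⊆ R) : Reach R 1 x y :=
  ⟨fun j => if j = 0 then x else y, by simp, by simp, fun m hm => by
    obtain rfl : m = 0 := by omega
    simpa using h⟩

lemma reach_of_chain {R : Set Plane} {k : ℕ} {P : ℕ → Plane}
    (hP : ∀ m < k, segment ℝ (P m) (P (m + 1)) ⊆ R) {m n : ℕ} (hmn : m ≤ n) (hn : n ≤ k) :
    Reach R (n - m) (P m) (P n) :=
  ⟨fun j => P (m + j), by simp, by simp [hmn], fun j hj => hP (m + j) (by omega)⟩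

lemma segment_subset_union_of_wedge_eq_zero {a b c : Plane} (h : wedge (b - a) (c - b) = 0) :
    segment ℝ a c ⊆ segment ℝ a b ∪ segment ℝ b c := by
  by_cases hab : b = a
  · subst hab; exact subset_union_right
  obtain ⟨μ, hμ⟩ : ∃ μ : ℝ, c - b = μ • (b - a) := by
    have hpos := sqDist_pos (Ne.symm hab)
    refine ⟨dotp (b - a) (c - b) / sqDist a b, ?_⟩
    have hne := hpos.ne'
    simp only [wedge, dotp, sqDist, Prod.fst_sub, Prod.snd_sub] at *
    ext
    · simp only [Prod.fst_sub, Prod.smul_fst, smul_eq_mul]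
      field_simp
      linear_combination (-(b.2 - a.2)) * h
    · simp only [Prod.snd_sub, Prod.smul_snd, smul_eq_mul]
      field_simp
      linear_combination (b.1 - a.1) * h
  obtain rfl : c = b + μ • (b - a) := by rw [← hμ]; abel
  intro z hz
  obtain ⟨t, t0, t1, rfl⟩ := mem_segment_iff.1 hz
  have e1 : a + t • (b + μ • (b - a) - a) = a + (t * (1 + μ)) • (b - a) := by
    ext <;> simp <;> ring
  rw [e1]
  by_cases h01 : 0 ≤ t * (1 + μ) ∧ t * (1 + μ) ≤ 1
  · exact Or.inl (mem_segment_iff.2 ⟨_, h01.1, h01.2, rfl⟩)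
  · refine Or.inr (mem_segment_iff.2 ⟨(t * (1 + μ) - 1) / μ, ?_⟩)
    have key : (0 < μ ∧ 1 < t * (1 + μ)) ∨ (μ < -1 ∧ t * (1 + μ) < 0) := by
      by_cases h0 : 0 ≤ t * (1 + μ)
      · have h1 : 1 < t * (1 + μ) := by
          by_contra hcon
          exact h01 ⟨h0, not_lt.1 hcon⟩
        exact Or.inl ⟨by nlinarith, h1⟩
      · exact Or.inr ⟨by nlinarith, not_le.1 h0⟩
    have hμ0 : μ ≠ 0 := by rcases key with h | h <;> linarith [h.1]
    refine ⟨?_, ?_, ?_⟩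
    · rcases key with h | h
      · exact div_nonneg (by linarith [h.2]) h.1.le
      · exact div_nonneg_of_nonpos (by linarith [h.2]) (by linarith [h.1])
    · rcases key with h | h
      · rw [div_le_one h.1]; nlinarith
      · rw [div_le_one_of_neg (by linarith [h.1])]; nlinarith
    · ext <;> simp <;> field_simp <;> ring

lemma exists_minimal_chain {R : Set Plane} {x y : Plane} (hxy : x ≠ y)
    (h : PolyConn R x y) : ∃ (k : ℕ) (P : ℕ → Plane), 0 < k ∧ P 0 = x ∧ P k = y ∧
      (∀ m < k, segment ℝ (P m) (P (m + 1)) ⊆ R) ∧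
      (∀ m n, m + 2 ≤ n → n < k →
        Disjoint (segment ℝ (P m) (P (m + 1))) (segment ℝ (P n) (P (n + 1)))) ∧
      ∀ m, m + 1 < k → wedge (P (m + 1) - P m) (P (m + 1 + 1) - P (m + 1)) ≠ 0 := by
  classical
  have hex : ∃ k, Reach R k x y := h.exists_chain
  obtain ⟨P, h0, hk, hP⟩ := Nat.find_spec hex
  set k := Nat.find hex with hkdef
  have hmin : ∀ j, Reach R j x y → k ≤ j := fun j hj => Nat.find_min' hex hj
  refine ⟨k, P, Nat.pos_of_ne_zero fun hk0 => ?_, h0, hk, hP, fun m n hmn hn => ?_,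
    fun m hm hw => ?_⟩
  · rw [hk0, h0] at hk
    exact hxy hk
  · rw [Set.disjoint_left]
    intro z hz hz'
    have r1 := reach_of_chain hP (Nat.zero_le m) (by omega : m ≤ k)
    have r2 : Reach R 1 (P m) z := .single <|
      ((convex_segment _ _).segment_subset (left_mem_segment ℝ _ _) hz).trans (hP m (by omega))
    have r3 : Reach R 1 z (P (n + 1)) := .single <|
      ((convex_segment _ _).segment_subset hz' (right_mem_segment ℝ _ _)).trans (hP n hn)
    have r4 := reach_of_chain hP (by omega : n + 1 ≤ k) le_rfl
    rw [h0] at r1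
    rw [hk] at r4
    have := hmin _ (((r1.trans r2).trans r3).trans r4)
    omega
  · have r1 := reach_of_chain hP (Nat.zero_le m) (by omega : m ≤ k)
    have r2 : Reach R 1 (P m) (P (m + 1 + 1)) := .single <|
      (segment_subset_union_of_wedge_eq_zero hw).trans
        (union_subset (hP m (by omega)) (hP (m + 1) hm))
    have r3 := reach_of_chain hP (by omega : m + 1 + 1 ≤ k) le_rfl
    rw [h0] at r1
    rw [hk] at r3
    have := hmin _ ((r1.trans r2).trans r3)
    omega

/-- Subdividing the first segment of a chain. -/
def subdivide (P : ℕ → Plane) (z : Plane) : ℕ → Plane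
  | 0 => P 0
  | 1 => z
  | m + 2 => P (m + 1)

/-- A chain of `k` segments that does not meet itself and never turns back. -/
structure SimpleChain (k : ℕ) (P : ℕ → Plane) : Prop where
  two_le : 2 ≤ k
  far : ∀ m n, m + 2 ≤ n → n < k →
    Disjoint (segment ℝ (P m) (P (m + 1))) (segment ℝ (P n) (P (n + 1)))
  near : ∀ m, m + 1 < k → wedge (P (m + 1) - P m) (P (m + 1 + 1) - P (m + 1)) ≠ 0 ∨
    0 < dotp (P (m + 1) - P m) (P (m + 1 + 1) - P (m + 1))

lemma SimpleChain.succ_ne {k : ℕ} {P : ℕ → Plane} (h : SimpleChain k P) {m : ℕ} (hm : m < k) :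
    P (m + 1) ≠ P m := by
  by_cases hm' : m + 1 < k
  · exact sub_ne_zero.1 (ne_zero_of_wedge_or_dotp (h.near m hm')).1
  · obtain ⟨n, rfl⟩ : ∃ n, m = n + 1 := ⟨m - 1, by have := h.two_le; omega⟩
    exact sub_ne_zero.1 (ne_zero_of_wedge_or_dotp (h.near n hm)).2

/-- The start of a simple chain lies on the first segment only. -/
lemma SimpleChain.eq_zero_of_start_mem {k : ℕ} {P : ℕ → Plane} (h : SimpleChain k P) {m : ℕ}
    (hm : m < k) (hz : P 0 ∈ segment ℝ (P m) (P (m + 1))) : m = 0 := by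
  by_contra hm0
  rcases (by omega : m = 1 ∨ 2 ≤ m) with rfl | h2
  · have := eq_of_mem_consecutive_segments (h.near 0 hm) (left_mem_segment ..) hz
    exact h.succ_ne (by omega : 0 < k) this.symm
  · exact Set.disjoint_left.1 (h.far 0 m h2 hm) (left_mem_segment ..) hz

/-- The end of a simple chain lies on the last segment only. -/
lemma SimpleChain.succ_eq_of_end_mem {k : ℕ} {P : ℕ → Plane} (h : SimpleChain k P) {m : ℕ}
    (hm : m < k) (hz : P k ∈ segment ℝ (P m) (P (m + 1))) : m + 1 = k := by
  by_contra hm0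
  obtain ⟨j, rfl⟩ : ∃ j, k = j + 1 := ⟨k - 1, by omega⟩
  rcases (by omega : m + 1 = j ∨ m + 2 ≤ j) with rfl | h2
  · have := eq_of_mem_consecutive_segments (h.near m (by omega)) hz (right_mem_segment ..)
    exact h.succ_ne (by omega : m + 1 < m + 1 + 1) this
  · exact Set.disjoint_left.1 (h.far m j h2 (by omega)) hz (right_mem_segment ..)

lemma segment_subdivide_subset (P : ℕ → Plane) {z : Plane} (hz : z ∈ segment ℝ (P 0) (P 1))
    (m : ℕ) : segment ℝ (subdivide P z m) (subdivide P z (m + 1)) ⊆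
      segment ℝ (P (m - 1)) (P (m - 1 + 1)) := by
  rcases m with _ | _ | m
  · exact (convex_segment _ _).segment_subset (left_mem_segment ..) hz
  · exact (convex_segment _ _).segment_subset hz (right_mem_segment ..)
  · exact subset_rfl

lemma simpleChain_subdivide {k : ℕ} {P : ℕ → Plane} (hk : 0 < k) (hne : P 1 ≠ P 0)
    (far : ∀ m n, m + 2 ≤ n → n < k →
      Disjoint (segment ℝ (P m) (P (m + 1))) (segment ℝ (P n) (P (n + 1))))
    (near : ∀ m, m + 1 < k → wedge (P (m + 1) - P m) (P (m + 1 + 1) - P (m + 1)) ≠ 0)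
    {τ : ℝ} (h0 : 0 < τ) (h1 : τ < 1) :
    SimpleChain (k + 1) (subdivide P (P 0 + τ • (P 1 - P 0))) := by
  have hz : P 0 + τ • (P 1 - P 0) ∈ segment ℝ (P 0) (P 1) :=
    mem_segment_iff.2 ⟨τ, h0.le, h1.le, rfl⟩
  have hpos : 0 < dotp (P 1 - P 0) (P 1 - P 0) := by
    have := sqDist_pos hne.symm
    simp only [sqDist, dotp, Prod.fst_sub, Prod.snd_sub] at *
    nlinarith
  refine ⟨by omega, fun m n hmn hn => ?_, fun m hm => ?_⟩
  · by_cases h02 : m = 0 ∧ n = 2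
    · obtain ⟨rfl, rfl⟩ := h02
      rw [Set.disjoint_left]
      intro y hy hy'
      have hy0 := segment_subdivide_subset P hz 0 hy
      have hy1 := segment_subdivide_subset P hz 2 hy'
      have := eq_of_mem_consecutive_segments (Or.inl (near 0 (by omega))) hy0 hy1
      subst this
      obtain ⟨s, s0, s1, e⟩ := mem_segment_iff.1 hy
      simp only [subdivide, add_sub_cancel_left, smul_smul] at e
      have h2 : (1 - s * τ) • (P (0 + 1) - P 0) = 0 := by
        rw [sub_smul, one_smul, sub_eq_zero]
        exact sub_eq_iff_eq_add'.2 e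
      rcases smul_eq_zero.1 h2 with h3 | h3
      · nlinarith
      · exact hne (sub_eq_zero.1 h3)
    · refine (far (m - 1) (n - 1) (by omega) (by omega)).mono (segment_subdivide_subset P hz m)
        (segment_subdivide_subset P hz n)
  · rcases m with _ | _ | m
    · right
      have : dotp (P 0 + τ • (P 1 - P 0) - P 0) (P 1 - (P 0 + τ • (P 1 - P 0))) =
          τ * (1 - τ) * dotp (P 1 - P 0) (P 1 - P 0) := by
        simp [dotp]; ring
      simp only [subdivide]
      rw [this]
      have : 0 < 1 - τ := by linarith
      positivity
    · left
      have : wedge (P 1 - (P 0 + τ • (P 1 - P 0))) (P (1 + 1) - P 1) =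
          (1 - τ) * wedge (P 1 - P 0) (P (1 + 1) - P 1) := by
        simp [wedge]; ring
      simp only [subdivide]
      rw [this]
      exact mul_ne_zero (by linarith) (near 0 (by omega))
    · left
      exact near (m + 1) (by omega)

end MinimalChains

section PolygonalSystem

open Filter Topology

variable {ι : Type*} {γ : ι → ℝ → Plane} {S : Set Plane} {ρ : ℝ} {a b : ι → Plane → Plane}
  {U : ι → Set Plane}

lemma wedge_neg_left (u v : Plane) : wedge (-u) v = -wedge u v := by
  simp [wedge]; ring

lemma wedge_swap (u v : Plane) : wedge u v = -wedge v u := by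
  simp [wedge]; ring

lemma wedge_eq_zero_of_common {u v d : Plane} (hd : d ≠ 0) (hu : wedge u d = 0)
    (hv : wedge v d = 0) : wedge u v = 0 := by
  have h : wedge u v • d = 0 := by
    simp only [wedge] at *
    ext
    · simp only [Prod.smul_fst, smul_eq_mul, Prod.fst_zero]
      linear_combination -u.1 * hv + v.1 * hu
    · simp only [Prod.smul_snd, smul_eq_mul, Prod.snd_zero]
      linear_combination -u.2 * hv + v.2 * hu
  exact (smul_eq_zero.1 h).resolve_right hd

lemma wedge_ne_zero_of_parallel {u v d d' : Plane} (hu0 : u ≠ 0) (hv0 : v ≠ 0)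
    (hu : wedge u d = 0) (hv : wedge v d' = 0) (h : wedge d d' ≠ 0) : wedge u v ≠ 0 := by
  intro h0
  have h1 : wedge d v = 0 := wedge_eq_zero_of_common hu0 (by rw [wedge_swap, hu, neg_zero])
    (by rw [wedge_swap, h0, neg_zero])
  exact h (wedge_eq_zero_of_common hv0 h1 (by rw [wedge_swap, hv, neg_zero]))

/-- The region of the plane in which the arc of `e` is redrawn. -/
def corridor (γ : ι → ℝ → Plane) (S : Set Plane) (a b : ι → Plane → Plane) (U : ι → Set Plane)
    (e : ι) : Set Plane :=
  U e ∪ ⋃ p ∈ {p | Meets γ S e p}, segment ℝ (a e p) (b e p)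

lemma mem_corridor {e : ι} {z : Plane} : z ∈ corridor γ S a b U e ↔
    z ∈ U e ∨ ∃ p, Meets γ S e p ∧ z ∈ segment ℝ (a e p) (b e p) := by
  simp [corridor]

lemma Corridors.mem_chords (hC : Corridors γ S ρ a b U) {e f : ι} (hef : e ≠ f) {z : Plane}
    (he : z ∈ corridor γ S a b U e) (hf : z ∈ corridor γ S a b U f) :
    ∃ p, Meets γ S e p ∧ Meets γ S f p ∧ z ∈ segment ℝ (a e p) (b e p) ∧
      z ∈ segment ℝ (a f p) (b f p) := by
  rcases mem_corridor.1 he with he | ⟨p, hp, he⟩ <;> rcases mem_corridor.1 hf with hf | ⟨q, hq, hf⟩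
  · exact absurd hf (Set.disjoint_left.1 (hC.disjoint e f hef) he)
  · exact absurd hf (Set.disjoint_left.1 (hC.disjoint_chord e f q hef hq) (subset_closure he))
  · exact absurd he (Set.disjoint_left.1 (hC.disjoint_chord f e p hef.symm hp) (subset_closure hf))
  · by_cases hpq : p = q
    · subst hpq
      exact ⟨p, hp, hq, he, hf⟩
    · exact absurd hf (Set.disjoint_left.1 (hC.chord_disjoint e f p q hpq hp hq) he)

/-- Away from `U e`, a segment in the corridor has to follow the chord. -/
lemma Corridors.exists_mem_chord (hC : Corridors γ S ρ a b U) (hS : S.Finite) {e : ι}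
    {p x y z w : Plane} (hp : Meets γ S e p) (hxy : segment ℝ x y ⊆ corridor γ S a b U e)
    (hz : z ∈ segment ℝ x y) (hw : w ∈ segment ℝ x y) (hzp : z ∈ segment ℝ (a e p) (b e p))
    (hzU : z ∉ closure (U e)) :
    ∃ τ : ℝ, 0 < τ ∧ τ < 1 ∧ z + τ • (w - z) ∈ segment ℝ (a e p) (b e p) := by
  set K : Set Plane := closure (U e) ∪
    ⋃ q ∈ {q | Meets γ S e q ∧ p ≠ q}, segment ℝ (a e q) (b e q) with hK
  have hKc : IsClosed K := isClosed_closure.union <|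
    (hS.subset fun q hq => hq.1.1).isClosed_biUnion fun q _ => (isCompact_segment _ _).isClosed
  have hzK : z ∉ K := by
    rintro (h | h)
    · exact hzU h
    · obtain ⟨q, ⟨hq, hpq⟩, hzq⟩ := mem_iUnion₂.1 h
      exact Set.disjoint_left.1 (hC.chord_disjoint e e p q hpq hp hq) hzp hzq
  have hev : ∀ᶠ τ in 𝓝 (0 : ℝ), z + τ • (w - z) ∈ Kᶜ := by
    have hc : Continuous fun τ : ℝ => z + τ • (w - z) := by fun_prop
    refine hc.continuousAt.eventually (hKc.isOpen_compl.mem_nhds ?_)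
    simpa using hzK
  obtain ⟨τ, hτ, hτ0, hτ1⟩ :=
    ((hev.filter_mono nhdsWithin_le_nhds).and (Ioo_mem_nhdsGT zero_lt_one)).exists
  refine ⟨τ, hτ0, hτ1, ?_⟩
  have hmem : z + τ • (w - z) ∈ segment ℝ x y :=
    (convex_segment _ _).segment_subset hz hw (mem_segment_iff.2 ⟨τ, hτ0.le, hτ1.le, rfl⟩)
  rcases mem_corridor.1 (hxy hmem) with h | ⟨q, hq, h⟩
  · exact absurd (Or.inl (subset_closure h)) hτ
  · by_cases hpq : p = q
    · rwa [hpq]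
    · exact absurd (Or.inr (mem_iUnion₂.2 ⟨q, ⟨hq, hpq⟩, h⟩)) hτ

lemma Corridors.wedge_eq_zero (hC : Corridors γ S ρ a b U) (hS : S.Finite) {e : ι}
    {p x y z w : Plane} (hp : Meets γ S e p) (hxy : segment ℝ x y ⊆ corridor γ S a b U e)
    (hz : z ∈ segment ℝ x y) (hw : w ∈ segment ℝ x y) (hzp : z ∈ segment ℝ (a e p) (b e p))
    (hzU : z ∉ closure (U e)) : wedge (w - z) (b e p - a e p) = 0 := by
  obtain ⟨τ, τ0, -, h⟩ := hC.exists_mem_chord hS hp hxy hz hw hzp hzU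
  obtain ⟨r, -, -, hr⟩ := mem_segment_iff.1 hzp
  obtain ⟨s, -, -, hs⟩ := mem_segment_iff.1 h
  have e1 := congrArg Prod.fst hr
  have e2 := congrArg Prod.snd hr
  have e3 := congrArg Prod.fst hs
  have e4 := congrArg Prod.snd hs
  simp only [Prod.fst_add, Prod.snd_add, Prod.smul_fst, Prod.smul_snd, Prod.fst_sub, Prod.snd_sub,
    smul_eq_mul, wedge] at *
  have : τ * ((w.1 - z.1) * ((b e p).2 - (a e p).2) - (w.2 - z.2) * ((b e p).1 - (a e p).1)) = 0 := by
    linear_combination ((b e p).2 - (a e p).2) * (e3 - e1) - ((b e p).1 - (a e p).1) * (e4 - e2)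
  exact (mul_eq_zero.1 this).resolve_left τ0.ne'

/-- Chords at the endpoints of an arc are radii of the disc. -/
lemma Corridors.exists_tip (hC : Corridors γ S ρ a b U) {e : ι} {p : Plane}
    (hne : γ e 0 ≠ γ e 1) (hp : Meets γ S e p) (h : p = γ e 0 ∨ p = γ e 1) :
    ∃ c, (c = a e p ∨ c = b e p) ∧ sqDist p c = ρ ∧
      segment ℝ (a e p) (b e p) = segment ℝ p c := by
  rcases h with rfl | rfl
  · exact ⟨_, Or.inr rfl, hC.circle_right e _ hp hne, by rw [hC.left_start]⟩
  · exact ⟨_, Or.inl rfl, hC.circle_left e _ hp hne.symm, by rw [hC.right_end, segment_symm]⟩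

lemma Corridors.tips (hC : Corridors γ S ρ a b U) {e f : ι} {p c d : Plane} (hef : e ≠ f)
    (he : Meets γ S e p) (hf : Meets γ S f p) (hc : c = a e p ∨ c = b e p) (hcρ : sqDist p c = ρ)
    (hd : d = a f p ∨ d = b f p) (hdρ : sqDist p d = ρ) :
    wedge (c - p) (d - p) ≠ 0 ∨ dotp (c - p) (d - p) < 0 := by
  refine wedge_or_dotp_of_sqDist_eq hC.pos hcρ hdρ ?_
  rintro rfl
  have := hC.distinct e f p hef he hf c hc hd
  rw [this, sqDist_self] at hcρ
  exact hC.pos.ne hcρ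

lemma Corridors.exists_simpleChain (hA : ArcSystem γ S) (hC : Corridors γ S ρ a b U)
    {T : Set Plane} (hT0 : ∀ e, γ e 0 ∈ T)
    (hT : ∀ e p, Meets γ S e p → p ∈ T → p = γ e 0 ∨ p = γ e 1) (e : ι) :
    ∃ (k : ℕ) (P : ℕ → Plane), SimpleChain k P ∧ P 0 = γ e 0 ∧ P k = γ e 1 ∧
      (∀ m < k, segment ℝ (P m) (P (m + 1)) ⊆ corridor γ S a b U e) ∧
      ∀ f m, e ≠ f → 0 < m → m < k → P m ∉ corridor γ S a b U f := by
  have hne : ∀ e, γ e 0 ≠ γ e 1 := fun e h =>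
    zero_ne_one (hA.injOn e (by simp) (by simp) h)
  have hM0 : Meets γ S e (γ e 0) := ⟨hA.start_mem e, 0, by simp, rfl⟩
  obtain ⟨k, P, hk, h0, h1, hP, far, near⟩ := exists_minimal_chain (hne e) (hC.conn e)
  have hP : ∀ m < k, segment ℝ (P m) (P (m + 1)) ⊆ corridor γ S a b U e := hP
  have hP1 : P 1 ≠ P 0 := by
    intro h
    rcases Nat.lt_or_ge 1 k with h2 | h2
    · apply near 0 h2
      simp [h, wedge]
    · obtain rfl : k = 1 := by omega
      rw [h0, h1] at h
      exact hne e h.symm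
  obtain ⟨c, hc, hcρ, hchord⟩ := hC.exists_tip (hne e) hM0 (Or.inl rfl)
  obtain ⟨τ, τ0, τ1, hτ⟩ := hC.exists_mem_chord hA.finite hM0 (hP 0 hk)
    (z := γ e 0) (w := P 1) (by rw [← h0]; exact left_mem_segment ..) (right_mem_segment ..)
    (by rw [hchord]; exact left_mem_segment ..) (hC.notMem e _ (hA.start_mem e))
  have hz : P 0 + τ • (P 1 - P 0) ∈ segment ℝ (P 0) (P 1) :=
    mem_segment_iff.2 ⟨τ, τ0.le, τ1.le, rfl⟩
  have hsub : ∀ m < k + 1, segment ℝ (subdivide P (P 0 + τ • (P 1 - P 0)) m)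
      (subdivide P (P 0 + τ • (P 1 - P 0)) (m + 1)) ⊆ corridor γ S a b U e := fun m hm =>
    (segment_subdivide_subset P hz m).trans (hP (m - 1) (by omega))
  refine ⟨k + 1, subdivide P (P 0 + τ • (P 1 - P 0)),
    simpleChain_subdivide hk hP1 far near τ0 τ1, h0, ?_, hsub, ?_⟩
  · obtain ⟨j, rfl⟩ : ∃ j, k = j + 1 := ⟨k - 1, by omega⟩
    exact h1
  · intro f m hef hm0 hm hmem
    rcases m with _ | _ | m
    · exact absurd hm0 (lt_irrefl 0)
    · obtain ⟨p, hp, hp', hzp, hzp'⟩ := hC.mem_chords hef (hP 0 hk hz) hmem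
      have hpe : p = γ e 0 := by
        by_contra hcon
        rw [← h0] at hτ hcon
        exact Set.disjoint_left.1 (hC.chord_disjoint e e p (P 0) hcon hp (h0 ▸ hM0)) hzp hτ
      subst hpe
      obtain ⟨d, hd, hdρ, hchord'⟩ := hC.exists_tip (hne f) hp' (hT f _ hp' (hT0 e))
      rw [hchord] at hzp
      rw [hchord'] at hzp'
      have := eq_start_of_mem_segments (hC.tips hef hp hp' hc hcρ hd hdρ) hzp hzp'
      rw [← h0, add_eq_left] at this
      rcases smul_eq_zero.1 this with h | h
      · exact τ0.ne' h
      · exact hP1 (sub_eq_zero.1 h)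
    · have hl := right_mem_segment ℝ (P m) (P (m + 1))
      have hr := left_mem_segment ℝ (P (m + 1)) (P (m + 1 + 1))
      simp only [subdivide] at hmem
      obtain ⟨p, hp, hp', hzp, hzp'⟩ := hC.mem_chords hef (hP m (by omega) hl) hmem
      have hU : P (m + 1) ∉ closure (U e) := fun h =>
        Set.disjoint_left.1 (hC.disjoint_chord e f p hef hp') h hzp'
      have w1 := hC.wedge_eq_zero hA.finite hp (hP m (by omega)) hl (left_mem_segment ..) hzp hU
      have w2 := hC.wedge_eq_zero hA.finite hp (hP (m + 1) (by omega)) hr (right_mem_segment ..)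
        hzp hU
      apply near m (by omega)
      have hd : b e p - a e p ≠ 0 := sub_ne_zero.2 (hC.ne e p hp).symm
      have w3 : wedge (P (m + 1) - P m) (b e p - a e p) = 0 := by
        rw [← neg_sub, wedge_neg_left, w1, neg_zero]
      exact wedge_eq_zero_of_common hd w3 w2

end PolygonalSystem

section PolygonalSystem

variable {ι : Type*} {γ : ι → ℝ → Plane} {S : Set Plane} {ρ : ℝ} {a b : ι → Plane → Plane}
  {U : ι → Set Plane}

/-- Segments `m` and `n` of two chains have a common end, which is an end of both chains, and do
not leave it in the same direction. -/
def ChainsJoined (k l : ℕ) (P Q : ℕ → Plane) (m n : ℕ) : Prop :=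
  ∃ i i' j j' : ℕ, ((i = m ∧ i' = m + 1) ∨ (i = m + 1 ∧ i' = m)) ∧ (i = 0 ∨ i = k) ∧
    ((j = n ∧ j' = n + 1) ∨ (j = n + 1 ∧ j' = n)) ∧ (j = 0 ∨ j = l) ∧ P i = Q j ∧
    (wedge (P i' - P i) (Q j' - Q j) ≠ 0 ∨ dotp (P i' - P i) (Q j' - Q j) < 0)

/-- A redrawing of a system of arcs by polygonal chains with the same endpoints. The relation
`X e f m n p` says that segment `m` of `e` and segment `n` of `f` cross because of the crossing
`p` of the original arcs. -/
structure PolySystem (γ : ι → ℝ → Plane) (T : Set Plane) (k : ι → ℕ) (P : ι → ℕ → Plane)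
    (X : ι → ι → ℕ → ℕ → Plane → Prop) : Prop where
  simple : ∀ e, SimpleChain (k e) (P e)
  start : ∀ e, P e 0 = γ e 0
  finish : ∀ e, P e (k e) = γ e 1
  end_of_mem : ∀ e m v, m < k e → v ∈ T → v ∈ segment ℝ (P e m) (P e (m + 1)) →
    (m = 0 ∧ v = P e 0) ∨ (m + 1 = k e ∧ v = P e (k e))
  joint : ∀ e f m n, e ≠ f → 0 < m → m < k e → n < k f →
    P e m ∉ segment ℝ (P f n) (P f (n + 1))
  cross : ∀ e f m n, e ≠ f → m < k e → n < k f →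
    ¬ Disjoint (segment ℝ (P e m) (P e (m + 1))) (segment ℝ (P f n) (P f (n + 1))) →
    ChainsJoined (k e) (k f) (P e) (P f) m n ∨ ∃ p, X e f m n p
  cross_spec : ∀ e f m n p, e ≠ f → m < k e → n < k f → X e f m n p →
    p ∉ T ∧ p ∈ γ e '' Icc 0 1 ∧ p ∈ γ f '' Icc 0 1 ∧
      wedge (P e (m + 1) - P e m) (P f (n + 1) - P f n) ≠ 0
  cross_uniq : ∀ e f m n m' n' p, e ≠ f → m < k e → n < k f → m' < k e → n' < k f →
    X e f m n p → X e f m' n' p → m = m' ∧ n = n'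

lemma wedge_or_dotp_smul {u v : Plane} {μ ν : ℝ} (h : wedge u v ≠ 0 ∨ dotp u v < 0) (hμ : 0 < μ)
    (hν : 0 < ν) : wedge (μ • u) (ν • v) ≠ 0 ∨ dotp (μ • u) (ν • v) < 0 := by
  have h1 : wedge (μ • u) (ν • v) = μ * ν * wedge u v := by simp [wedge]; ring
  have h2 : dotp (μ • u) (ν • v) = μ * ν * dotp u v := by simp [dotp]; ring
  have := mul_pos hμ hν
  rw [h1, h2]
  exact h.imp (fun h => mul_ne_zero this.ne' h) fun h => by nlinarith

/-- A segment of a corridor that starts at the end of an arc follows the chord there. -/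
lemma Corridors.exists_pos_smul (hC : Corridors γ S ρ a b U) (hS : S.Finite) {e : ι}
    {p x c : Plane} (hp : Meets γ S e p) (hpx : x ≠ p)
    (hx : segment ℝ p x ⊆ corridor γ S a b U e)
    (hchord : segment ℝ (a e p) (b e p) = segment ℝ p c) :
    ∃ μ : ℝ, 0 < μ ∧ x - p = μ • (c - p) := by
  obtain ⟨τ, τ0, -, h⟩ := hC.exists_mem_chord hS hp hx (left_mem_segment ..)
    (right_mem_segment ..) (by rw [hchord]; exact left_mem_segment ..) (hC.notMem e p hp.1)
  rw [hchord] at h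
  obtain ⟨r, r0, -, hr⟩ := mem_segment_iff.1 h
  have hr : τ • (x - p) = r • (c - p) := add_left_cancel hr
  have hxp : x - p = (r / τ) • (c - p) := by
    rw [div_eq_inv_mul, mul_smul, ← hr, smul_smul, inv_mul_cancel₀ τ0.ne', one_smul]
  refine ⟨r / τ, (div_nonneg r0 τ0.le).lt_of_ne ?_, hxp⟩
  intro h0
  rw [← h0, zero_smul, sub_eq_zero] at hxp
  exact hpx hxp

theorem ArcSystem.exists_polySystem [Finite ι] (hA : ArcSystem γ S) {T : Set Plane} (hTS : T ⊆ S)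
    (hT0 : ∀ e, γ e 0 ∈ T) (hT1 : ∀ e, γ e 1 ∈ T)
    (hT : ∀ e p, Meets γ S e p → p ∈ T → p = γ e 0 ∨ p = γ e 1) :
    ∃ k P X, PolySystem γ T k P X := by
  obtain ⟨ρ, a, b, U, hC⟩ := hA.exists_corridors
  have hne : ∀ e, γ e 0 ≠ γ e 1 := fun e h =>
    zero_ne_one (hA.injOn e (by simp) (by simp) h)
  choose k P hP h0 h1 hsub hbrk using hC.exists_simpleChain hA hT0 hT
  have end_of_mem : ∀ e m v, m < k e → v ∈ T → v ∈ segment ℝ (P e m) (P e (m + 1)) →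
      (m = 0 ∧ v = P e 0) ∨ (m + 1 = k e ∧ v = P e (k e)) := by
    intro e m v hm hv hmem
    have hve : v = γ e 0 ∨ v = γ e 1 := by
      rcases mem_corridor.1 (hsub e m hm hmem) with h | ⟨p, hp, h⟩
      · exact absurd (subset_closure h) (hC.notMem e v (hTS hv))
      · have := hC.eq_of_mem_chord e p v hp (hTS hv) h
        subst this
        exact hT e v hp hv
    rcases hve with rfl | rfl
    · rw [← h0] at hmem ⊢
      exact Or.inl ⟨(hP e).eq_zero_of_start_mem hm hmem, rfl⟩
    · rw [← h1] at hmem ⊢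
      exact Or.inr ⟨(hP e).succ_eq_of_end_mem hm hmem, rfl⟩
  have joint : ∀ e f m n, e ≠ f → 0 < m → m < k e → n < k f →
      P e m ∉ segment ℝ (P f n) (P f (n + 1)) := fun e f m n hef hm hm' hn h =>
    hbrk e f m hef hm hm' (hsub f n hn h)
  have tip : ∀ e m p, m < k e → Meets γ S e p → p ∈ T → p ∈ segment ℝ (P e m) (P e (m + 1)) →
      ∃ i i', ((i = m ∧ i' = m + 1) ∨ (i = m + 1 ∧ i' = m)) ∧ (i = 0 ∨ i = k e) ∧ p = P e i ∧
        ∀ c, segment ℝ (a e p) (b e p) = segment ℝ p c →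
          ∃ μ : ℝ, 0 < μ ∧ P e i' - P e i = μ • (c - p) := by
    intro e m p hm hp hpT hmem
    have hstep := (hP e).succ_ne hm
    have hseg := hsub e m hm
    rcases end_of_mem e m p hm hpT hmem with ⟨rfl, rfl⟩ | ⟨hk, rfl⟩
    · exact ⟨0, 1, by simp, by simp, rfl, fun c hc => hC.exists_pos_smul hA.finite hp hstep hseg hc⟩
    · rw [← hk] at hp ⊢
      exact ⟨m + 1, m, by simp, by simp, rfl, fun c hc =>
        hC.exists_pos_smul hA.finite hp hstep.symm (by rwa [segment_symm]) hc⟩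
  set X : ι → ι → ℕ → ℕ → Plane → Prop := fun e f m n p => p ∉ T ∧ Meets γ S e p ∧ Meets γ S f p ∧
    ∃ z, z ∈ segment ℝ (P e m) (P e (m + 1)) ∧ z ∈ segment ℝ (P f n) (P f (n + 1)) ∧
      z ∈ segment ℝ (a e p) (b e p) ∧ z ∈ segment ℝ (a f p) (b f p)
  have chords : ∀ e f p z, e ≠ f → p ∉ T → Meets γ S e p → Meets γ S f p →
      z ∈ segment ℝ (a e p) (b e p) → z ∈ segment ℝ (a f p) (b f p) →
      wedge (b e p - a e p) (b f p - a f p) ≠ 0 := by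
    intro e f p z hef hpT hp hp' hz hz'
    have hn0 : ∀ e, p ≠ γ e 0 := fun e h => hpT (h ▸ hT0 e)
    have hn1 : ∀ e, p ≠ γ e 1 := fun e h => hpT (h ▸ hT1 e)
    have aux : ∀ c, sqDist p c = ρ → c ≠ p := by
      rintro c hc rfl
      rw [sqDist_self] at hc
      exact hC.pos.ne hc
    have hd := hC.distinct e f p hef hp hp'
    have hca := hC.circle_left f p hp' (hn0 f)
    refine wedge_ne_zero_of_chords (hC.circle_left e p hp (hn0 e))
      (hC.circle_right e p hp (hn1 e)) hca (hC.ne e p hp) ?_ ?_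
      (Set.not_disjoint_iff.2 ⟨z, hz, hz'⟩)
    · exact fun h => aux _ hca (hd _ (Or.inl h) (Or.inl rfl))
    · exact fun h => aux _ hca (hd _ (Or.inr h) (Or.inl rfl))
  have along : ∀ e f m p z, e ≠ f → m < k e → Meets γ S e p → Meets γ S f p →
      z ∈ segment ℝ (P e m) (P e (m + 1)) → z ∈ segment ℝ (a e p) (b e p) →
      z ∈ segment ℝ (a f p) (b f p) →
      wedge (P e (m + 1) - P e m) (b e p - a e p) = 0 := by
    intro e f m p z hef hm hp hp' hz hze hzf
    have hU : z ∉ closure (U e) := fun h =>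
      Set.disjoint_left.1 (hC.disjoint_chord e f p hef hp') h hzf
    have w1 := hC.wedge_eq_zero hA.finite hp (hsub e m hm) hz (left_mem_segment ..) hze hU
    have w2 := hC.wedge_eq_zero hA.finite hp (hsub e m hm) hz (right_mem_segment ..) hze hU
    simp only [wedge, Prod.fst_sub, Prod.snd_sub] at *
    linear_combination w2 - w1
  have same : ∀ e f m m' n z, e ≠ f → m < k e → m' < k e → n < k f →
      z ∈ segment ℝ (P e m) (P e (m + 1)) → z ∈ segment ℝ (P e m') (P e (m' + 1)) →
      z ∈ segment ℝ (P f n) (P f (n + 1)) → m ≤ m' → m = m' := by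
    intro e f m m' n z hef hm hm' hn hz hz' hzf hle
    by_contra hmm
    rcases (by omega : m + 1 = m' ∨ m + 2 ≤ m') with rfl | h2
    · have := eq_of_mem_consecutive_segments ((hP e).near m hm') hz hz'
      subst this
      exact joint e f (m + 1) n hef (by omega) hm' hn hzf
    · exact Set.disjoint_left.1 ((hP e).far m m' h2 hm') hz hz'
  refine ⟨k, P, X, hP, h0, h1, end_of_mem, joint, ?_, ?_, ?_⟩
  · intro e f m n hef hm hn hcap
    obtain ⟨z, hz, hz'⟩ := Set.not_disjoint_iff.1 hcap
    obtain ⟨p, hp, hp', hzp, hzp'⟩ := hC.mem_chords hef (hsub e m hm hz) (hsub f n hn hz')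
    by_cases hpT : p ∈ T
    · left
      obtain ⟨c, hc, hcρ, hce⟩ := hC.exists_tip (hne e) hp (hT e p hp hpT)
      obtain ⟨d, hd, hdρ, hdf⟩ := hC.exists_tip (hne f) hp' (hT f p hp' hpT)
      have htips := hC.tips hef hp hp' hc hcρ hd hdρ
      have hzeq : z = p := eq_start_of_mem_segments htips (hce ▸ hzp) (hdf ▸ hzp')
      subst hzeq
      obtain ⟨i, i', hi, hi', hpi, hμ⟩ := tip e m z hm hp hpT hz
      obtain ⟨j, j', hj, hj', hpj, hν⟩ := tip f n z hn hp' hpT hz'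
      obtain ⟨μ, μ0, hμ⟩ := hμ c hce
      obtain ⟨ν, ν0, hν⟩ := hν d hdf
      refine ⟨i, i', j, j', hi, hi', hj, hj', hpi.symm.trans hpj, ?_⟩
      rw [hμ, hν]
      exact wedge_or_dotp_smul htips μ0 ν0
    · exact Or.inr ⟨p, hpT, hp, hp', z, hz, hz', hzp, hzp'⟩
  · rintro e f m n p hef hm hn ⟨hpT, hp, hp', z, hz, hz', hzp, hzp'⟩
    refine ⟨hpT, hp.2, hp'.2, ?_⟩
    exact wedge_ne_zero_of_parallel (sub_ne_zero.2 ((hP e).succ_ne hm))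
      (sub_ne_zero.2 ((hP f).succ_ne hn)) (along e f m p z hef hm hp hp' hz hzp hzp')
      (along f e n p z hef.symm hn hp' hp hz' hzp' hzp)
      (chords e f p z hef hpT hp hp' hzp hzp')
  · rintro e f m n m' n' p hef hm hn hm' hn' ⟨hpT, hp, hp', z, hz, hz', hzp, hzp'⟩
      ⟨-, -, -, y, hy, hy', hyp, hyp'⟩
    have hzy : z = y := eq_of_mem_segments_of_wedge_ne
      (chords e f p z hef hpT hp hp' hzp hzp') hzp hzp' hyp hyp'
    subst hzy
    constructor
    · rcases le_total m m' with h | h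
      · exact same e f m m' n z hef hm hm' hn hz hy hz' h
      · exact (same e f m' m n z hef hm' hm hn hy hz hz' h).symm
    · rcases le_total n n' with h | h
      · exact same f e n n' m z hef.symm hn hn' hm hz' hy' hz h
      · exact (same f e n' n m z hef.symm hn' hn hm hy' hz' hz h).symm

end PolygonalSystem

section Copies

open Filter Topology

variable {ι : Type*} {γ : ι → ℝ → Plane} {T : Set Plane} {k : ι → ℕ} {P : ι → ℕ → Plane}
  {X : ι → ι → ℕ → ℕ → Plane → Prop}

lemma wedge_or_dotp_of_common_normal {u v n : Plane} (hu : 0 < wedge u n) (hv : 0 < wedge v n) :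
    wedge u v ≠ 0 ∨ 0 < dotp u v := by
  by_contra! hcon
  obtain ⟨h0, h1⟩ := hcon
  have key : dotp u v * wedge u n = dotp u u * wedge v n + wedge u v * dotp u n := by
    simp only [dotp, wedge]; ring
  have hu0 : 0 < dotp u u := by
    have : u ≠ 0 := by rintro rfl; simp [wedge] at hu
    have := sqDist_pos (p := 0) (z := u) this.symm
    simp only [sqDist, dotp, Prod.fst_zero, Prod.snd_zero] at *
    nlinarith
  rw [h0, zero_mul, add_zero] at key
  nlinarith [mul_pos hu0 hv]

/-- The copy with parameter `s` of a chain, shifted along the directions `N`. -/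
def shift (P N : ℕ → Plane) (s : ℝ) (m : ℕ) : Plane := P m + s • N m

lemma shift_zero (P N : ℕ → Plane) (m : ℕ) : shift P N 0 m = P m := by simp [shift]

lemma shift_of_eq_zero {P N : ℕ → Plane} {m : ℕ} (h : N m = 0) (s : ℝ) : shift P N s m = P m := by
  simp [shift, h]

@[fun_prop]
lemma continuous_shift {Y : Type*} [TopologicalSpace Y] (P N : ℕ → Plane) {f : Y → ℝ}
    (hf : Continuous f) (m : ℕ) : Continuous fun y => shift P N (f y) m := by
  unfold shift; fun_prop

/-- Directions in which all inner vertices of a chain can be shifted to its left. -/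
structure Normals (k : ℕ) (P N : ℕ → Plane) : Prop where
  zero : N 0 = 0
  top : N k = 0
  left : ∀ m, m + 1 < k → 0 < wedge (P (m + 1) - P m) (N (m + 1))
  right : ∀ m, m + 1 < k → 0 < wedge (P (m + 1 + 1) - P (m + 1)) (N (m + 1))

lemma SimpleChain.exists_normals {k : ℕ} {P : ℕ → Plane} (h : SimpleChain k P) :
    ∃ N, Normals k P N := by
  have hex : ∀ m, ∃ n, m + 1 < k → 0 < wedge (P (m + 1) - P m) n ∧
      0 < wedge (P (m + 1 + 1) - P (m + 1)) n := by
    intro m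
    by_cases hm : m + 1 < k
    · obtain ⟨n, hn⟩ := exists_common_normal (h.near m hm)
      exact ⟨n, fun _ => hn⟩
    · exact ⟨0, fun h => absurd h hm⟩
  choose n hn using hex
  have h2 := h.two_le
  refine ⟨fun m => if m = k then 0 else m.casesOn 0 n, ?_, by simp, fun m hm => ?_, fun m hm => ?_⟩
  · simp
  · simpa [hm.ne] using (hn m hm).1
  · simpa [hm.ne] using (hn m hm).2

/-- Infinitely many copies of the chains of a system, which meet as little as possible. -/
structure CopySystem (γ : ι → ℝ → Plane) (T : Set Plane) (k : ι → ℕ)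
    (X : ι → ι → ℕ → ℕ → Plane → Prop) (C : ι → ℕ → ℕ → Plane) : Prop where
  simple : ∀ e i, SimpleChain (k e) (C e i)
  start : ∀ e i, C e i 0 = γ e 0
  finish : ∀ e i, C e i (k e) = γ e 1
  end_of_mem : ∀ e i m v, m < k e → v ∈ T → v ∈ segment ℝ (C e i m) (C e i (m + 1)) →
    (m = 0 ∧ v = C e i 0) ∨ (m + 1 = k e ∧ v = C e i (k e))
  copies : ∀ e i j m n z, i ≠ j → m < k e → n < k e → z ∈ segment ℝ (C e i m) (C e i (m + 1)) →
    z ∈ segment ℝ (C e j n) (C e j (n + 1)) → z = γ e 0 ∨ z = γ e 1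
  cross : ∀ e f i j m n z, e ≠ f → m < k e → n < k f → z ∈ segment ℝ (C e i m) (C e i (m + 1)) →
    z ∈ segment ℝ (C f j n) (C f j (n + 1)) → z = γ e 0 ∨ z = γ e 1 ∨
      ((∃ p, X e f m n p) ∧ wedge (C e i (m + 1) - C e i m) (C f j (n + 1) - C f j n) ≠ 0)
  joint : ∀ e f i j n, e ≠ f → n < k f → C e i 1 ∉ segment ℝ (C f j n) (C f j (n + 1))

lemma SimpleChain.eventually_shift {k : ℕ} {P N : ℕ → Plane} (h : SimpleChain k P)
    (hN : Normals k P N) : ∀ᶠ x : ℝ × ℝ in 𝓝 0,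
      (∀ m ∈ Iio k, m + 1 < k →
        0 < wedge (shift P N x.1 (m + 1) - shift P N x.1 m) (N (m + 1)) ∧
        0 < wedge (shift P N x.1 (m + 1 + 1) - shift P N x.1 (m + 1)) (N (m + 1))) ∧
      ∀ m ∈ Iio k, ∀ n ∈ Iio k, m + 2 ≤ n →
        Disjoint (segment ℝ (shift P N x.1 m) (shift P N x.1 (m + 1)))
          (segment ℝ (shift P N x.2 n) (shift P N x.2 (n + 1))) := by
  refine Filter.Eventually.and ?_ ?_
  · rw [eventually_all_finite (finite_Iio k)]; intro m _
    by_cases hm : m + 1 < k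
    · simp only [hm, true_imp_iff]
      refine Filter.Eventually.and ?_ ?_
      · have hc : Continuous fun x : ℝ × ℝ =>
          wedge (shift P N x.1 (m + 1) - shift P N x.1 m) (N (m + 1)) := by fun_prop
        exact (hc.tendsto 0).eventually_const_lt (by simpa [shift_zero] using hN.left m hm)
      · have hc : Continuous fun x : ℝ × ℝ =>
          wedge (shift P N x.1 (m + 1 + 1) - shift P N x.1 (m + 1)) (N (m + 1)) := by fun_prop
        exact (hc.tendsto 0).eventually_const_lt (by simpa [shift_zero] using hN.right m hm)
    · simp [hm]
  · rw [eventually_all_finite (finite_Iio k)]; intro m _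
    rw [eventually_all_finite (finite_Iio k)]; intro n hn
    by_cases hmn : m + 2 ≤ n
    · simp only [hmn, true_imp_iff]
      refine eventually_disjoint_segments (by fun_prop) (by fun_prop) (by fun_prop) (by fun_prop) ?_
      simpa [shift_zero] using h.far m n hmn hn
    · simp [hmn]

lemma simpleChain_shift {k : ℕ} {P N : ℕ → Plane} {s : ℝ} (hk : 2 ≤ k)
    (h1 : ∀ m ∈ Iio k, m + 1 < k →
        0 < wedge (shift P N s (m + 1) - shift P N s m) (N (m + 1)) ∧
        0 < wedge (shift P N s (m + 1 + 1) - shift P N s (m + 1)) (N (m + 1)))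
    (h2 : ∀ m ∈ Iio k, ∀ n ∈ Iio k, m + 2 ≤ n →
        Disjoint (segment ℝ (shift P N s m) (shift P N s (m + 1)))
          (segment ℝ (shift P N s n) (shift P N s (n + 1)))) :
    SimpleChain k (shift P N s) := by
  refine ⟨hk, fun m n hmn hn => h2 m (mem_Iio.2 (by omega)) n hn hmn, fun m hm => ?_⟩
  obtain ⟨h3, h4⟩ := h1 m (mem_Iio.2 (by omega)) hm
  exact wedge_or_dotp_of_common_normal h3 h4

/-- Distinct copies of a chain meet at its ends only. -/
lemma eq_end_of_mem_copies {k : ℕ} {P N : ℕ → Plane} (hN : Normals k P N) {s s' : ℝ}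
    (hk : 2 ≤ k) (hss : s ≠ s')
    (h1 : ∀ m ∈ Iio k, m + 1 < k →
        0 < wedge (shift P N s (m + 1) - shift P N s m) (N (m + 1)) ∧
        0 < wedge (shift P N s (m + 1 + 1) - shift P N s (m + 1)) (N (m + 1)))
    (h1' : ∀ m ∈ Iio k, m + 1 < k →
        0 < wedge (shift P N s' (m + 1) - shift P N s' m) (N (m + 1)) ∧
        0 < wedge (shift P N s' (m + 1 + 1) - shift P N s' (m + 1)) (N (m + 1)))
    (h2 : ∀ m ∈ Iio k, ∀ n ∈ Iio k, m + 2 ≤ n →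
        Disjoint (segment ℝ (shift P N s m) (shift P N s (m + 1)))
          (segment ℝ (shift P N s' n) (shift P N s' (n + 1))))
    {m n : ℕ} {z : Plane} (hn : n < k) (hmn : m ≤ n)
    (hz : z ∈ segment ℝ (shift P N s m) (shift P N s (m + 1)))
    (hz' : z ∈ segment ℝ (shift P N s' n) (shift P N s' (n + 1))) : z = P 0 ∨ z = P k := by
  rcases (by omega : m = n ∨ m + 1 = n ∨ m + 2 ≤ n) with rfl | rfl | h
  · obtain ⟨t, t0, t1, rfl, ht⟩ := mem_copies_of_segment hss hz hz'
    have hr : 0 < m → 0 < wedge (shift P N s' (m + 1) - shift P N s' m) (N m) := by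
      intro hm0
      obtain ⟨j, rfl⟩ : ∃ j, m = j + 1 := ⟨m - 1, by omega⟩
      exact (h1' j (mem_Iio.2 (by omega)) hn).2
    have hl : m + 1 < k → 0 < wedge (shift P N s' (m + 1) - shift P N s' m) (N (m + 1)) :=
      fun hm => (h1' m hn hm).1
    change (1 - t) * wedge (shift P N s' (m + 1) - shift P N s' m) (N m) +
      t * wedge (shift P N s' (m + 1) - shift P N s' m) (N (m + 1)) = 0 at ht
    rcases Nat.eq_zero_or_pos m with rfl | hm0
    · left
      have hw : wedge (shift P N s' (0 + 1) - shift P N s' 0) (N 0) = 0 := by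
        simp [hN.zero, wedge]
      rw [hw, mul_zero, zero_add] at ht
      have ht0 := (mul_eq_zero.1 ht).resolve_right (hl (by omega)).ne'
      simp [ht0, hN.zero]
    · rcases (by omega : m + 1 = k ∨ m + 1 < k) with hm | hm
      · right
        have hw : wedge (shift P N s' (m + 1) - shift P N s' m) (N (m + 1)) = 0 := by
          simp [hm, hN.top, wedge]
        rw [hw, mul_zero, add_zero] at ht
        have ht1 : t = 1 := by
          linarith [(mul_eq_zero.1 ht).resolve_right (hr hm0).ne']
        simp [ht1, hm, hN.top]
      · have h3 := hr hm0
        have h4 := hl hm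
        rcases t0.eq_or_lt with h5 | h5
        · rw [← h5] at ht
          linarith
        · nlinarith [mul_pos h5 h4, mul_nonneg (sub_nonneg.2 t1) h3.le]
  · exact absurd (eq_of_mem_consecutive_copies (h1 m (mem_Iio.2 (by omega)) hn).1
      (h1' m (mem_Iio.2 (by omega)) hn).2 hz hz').1 hss
  · exact absurd hz' (Set.disjoint_left.1 (h2 m (mem_Iio.2 (by omega)) n hn h) hz)

end Copies

section ShiftedCopies

open Filter Topology

variable {ι : Type*} {γ : ι → ℝ → Plane} {T : Set Plane} {k : ι → ℕ} {P N : ι → ℕ → Plane}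
  {X : ι → ι → ℕ → ℕ → Plane → Prop}

lemma ChainsJoined.eventually_shift {k l m n : ℕ} {P Q N M : ℕ → Plane}
    (h : ChainsJoined k l P Q m n) (hN : Normals k P N) (hM : Normals l Q M) :
    ∀ᶠ x : ℝ × ℝ in 𝓝 0, ∀ z, z ∈ segment ℝ (shift P N x.1 m) (shift P N x.1 (m + 1)) →
      z ∈ segment ℝ (shift Q M x.2 n) (shift Q M x.2 (n + 1)) → z = P 0 ∨ z = P k := by
  obtain ⟨i, i', j, j', hi, hik, hj, hjl, hij, hw⟩ := h
  have hNi : N i = 0 := by rcases hik with rfl | rfl; exacts [hN.zero, hN.top]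
  have hMj : M j = 0 := by rcases hjl with rfl | rfl; exacts [hM.zero, hM.top]
  have hev : ∀ᶠ x : ℝ × ℝ in 𝓝 0, wedge (shift P N x.1 i' - P i) (shift Q M x.2 j' - Q j) ≠ 0 ∨
      dotp (shift P N x.1 i' - P i) (shift Q M x.2 j' - Q j) < 0 :=
    eventually_wedge_or_dotp (by fun_prop) (by fun_prop) (by simpa [shift_zero] using hw)
  filter_upwards [hev] with x hx z hz hz'
  have h1 : z ∈ segment ℝ (P i) (shift P N x.1 i') := by
    rw [← shift_of_eq_zero (P := P) hNi x.1]
    rcases hi with ⟨rfl, rfl⟩ | ⟨rfl, rfl⟩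
    · exact hz
    · rwa [segment_symm]
  have h2 : z ∈ segment ℝ (P i) (shift Q M x.2 j') := by
    rw [hij, ← shift_of_eq_zero (P := Q) hMj x.2]
    rcases hj with ⟨rfl, rfl⟩ | ⟨rfl, rfl⟩
    · exact hz'
    · rwa [segment_symm]
  rw [← hij] at hx
  have := eq_start_of_mem_segments hx h1 h2
  subst this
  rcases hik with rfl | rfl
  · exact Or.inl rfl
  · exact Or.inr rfl

lemma PolySystem.eventually_cross (hP : PolySystem γ T k P X)
    (hN : ∀ e, Normals (k e) (P e) (N e)) {e f : ι} {m n : ℕ} (hef : e ≠ f) (hm : m < k e)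
    (hn : n < k f) :
    ∀ᶠ x : ℝ × ℝ in 𝓝 0, ∀ z,
      z ∈ segment ℝ (shift (P e) (N e) x.1 m) (shift (P e) (N e) x.1 (m + 1)) →
      z ∈ segment ℝ (shift (P f) (N f) x.2 n) (shift (P f) (N f) x.2 (n + 1)) →
      z = γ e 0 ∨ z = γ e 1 ∨ ((∃ p, X e f m n p) ∧
        wedge (shift (P e) (N e) x.1 (m + 1) - shift (P e) (N e) x.1 m)
          (shift (P f) (N f) x.2 (n + 1) - shift (P f) (N f) x.2 n) ≠ 0) := by
  by_cases hd : Disjoint (segment ℝ (P e m) (P e (m + 1))) (segment ℝ (P f n) (P f (n + 1)))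
  · have : ∀ᶠ x : ℝ × ℝ in 𝓝 0,
        Disjoint (segment ℝ (shift (P e) (N e) x.1 m) (shift (P e) (N e) x.1 (m + 1)))
          (segment ℝ (shift (P f) (N f) x.2 n) (shift (P f) (N f) x.2 (n + 1))) :=
      eventually_disjoint_segments (by fun_prop) (by fun_prop) (by fun_prop) (by fun_prop)
        (by simpa [shift_zero] using hd)
    filter_upwards [this] with x hx z hz hz'
    exact absurd hz' (Set.disjoint_left.1 hx hz)
  · rcases hP.cross e f m n hef hm hn hd with h | ⟨p, hX⟩
    · filter_upwards [h.eventually_shift (hN e) (hN f)] with x hx z hz hz'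
      rw [← hP.start, ← hP.finish]
      exact (hx z hz hz').imp_right Or.inl
    · have hc : Continuous fun x : ℝ × ℝ =>
          wedge (shift (P e) (N e) x.1 (m + 1) - shift (P e) (N e) x.1 m)
            (shift (P f) (N f) x.2 (n + 1) - shift (P f) (N f) x.2 n) := by fun_prop
      have := hc.continuousAt.eventually_ne (x := 0)
        (by simpa [shift_zero] using (hP.cross_spec e f m n p hef hm hn hX).2.2.2)
      filter_upwards [this] with x hx z _ _
      exact Or.inr (Or.inr ⟨⟨p, hX⟩, hx⟩)

lemma PolySystem.eventually_notMem (hP : PolySystem γ T k P X) {e f : ι} {n : ℕ} (hef : e ≠ f)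
    (hn : n < k f) : ∀ᶠ x : ℝ × ℝ in 𝓝 0, shift (P e) (N e) x.1 1 ∉
      segment ℝ (shift (P f) (N f) x.2 n) (shift (P f) (N f) x.2 (n + 1)) := by
  have : ∀ᶠ x : ℝ × ℝ in 𝓝 0,
      Disjoint (segment ℝ (shift (P e) (N e) x.1 1) (shift (P e) (N e) x.1 1))
        (segment ℝ (shift (P f) (N f) x.2 n) (shift (P f) (N f) x.2 (n + 1))) :=
    eventually_disjoint_segments (by fun_prop) (by fun_prop) (by fun_prop) (by fun_prop)
      (by simpa [shift_zero] using hP.joint e f 1 n hef one_pos (hP.simple e).two_le hn)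
  filter_upwards [this] with x hx
  simpa using hx

lemma PolySystem.eventually_end_of_mem (hP : PolySystem γ T k P X)
    (hN : ∀ e, Normals (k e) (P e) (N e)) {e : ι} {m : ℕ} {v : Plane} (hm : m < k e) (hv : v ∈ T) :
    ∀ᶠ x : ℝ × ℝ in 𝓝 0,
      v ∈ segment ℝ (shift (P e) (N e) x.1 m) (shift (P e) (N e) x.1 (m + 1)) →
      (m = 0 ∧ v = shift (P e) (N e) x.1 0) ∨ (m + 1 = k e ∧ v = shift (P e) (N e) x.1 (k e)) := by
  by_cases h : v ∈ segment ℝ (P e m) (P e (m + 1))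
  · refine Eventually.of_forall fun x _ => ?_
    rw [shift_of_eq_zero (hN e).zero, shift_of_eq_zero (hN e).top]
    exact hP.end_of_mem e m v hm hv h
  · have : ∀ᶠ x : ℝ × ℝ in 𝓝 0, Disjoint (segment ℝ v v)
        (segment ℝ (shift (P e) (N e) x.1 m) (shift (P e) (N e) x.1 (m + 1))) :=
      eventually_disjoint_segments (by fun_prop) (by fun_prop) (by fun_prop) (by fun_prop)
        (by simpa [shift_zero] using h)
    filter_upwards [this] with x hx hv'
    simp only [segment_same, disjoint_singleton_left] at hx
    exact absurd hv' hx

theorem PolySystem.exists_copySystem [Finite ι] (hP : PolySystem γ T k P X) (hT : T.Finite) :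
    ∃ C, CopySystem γ T k X C := by
  choose N hN using fun e => (hP.simple e).exists_normals
  have hev1 := eventually_all.2 fun e => (hP.simple e).eventually_shift (hN e)
  have hev2 := eventually_all.2 fun e => (eventually_all_finite (finite_Iio (k e))).2 fun m hm =>
    (eventually_all_finite hT).2 fun v hv => hP.eventually_end_of_mem hN (mem_Iio.1 hm) hv
  have hev3 := eventually_all.2 fun ef : {ef : ι × ι // ef.1 ≠ ef.2} =>
    (eventually_all_finite (finite_Iio (k ef.1.1))).2 fun m hm =>
    (eventually_all_finite (finite_Iio (k ef.1.2))).2 fun n hn =>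
      hP.eventually_cross hN ef.2 (mem_Iio.1 hm) (mem_Iio.1 hn)
  have hev4 := eventually_all.2 fun ef : {ef : ι × ι // ef.1 ≠ ef.2} =>
    (eventually_all_finite (finite_Iio (k ef.1.2))).2 fun n hn =>
      hP.eventually_notMem (N := N) ef.2 (mem_Iio.1 hn)
  obtain ⟨δ, hδ, hball⟩ := Metric.eventually_nhds_iff.1 (((hev1.and hev2).and hev3).and hev4)
  set s : ℕ → ℝ := fun i => δ / (i + 2) with hs
  have hs0 (i) : 0 < s i := by positivity
  have hsδ (i) : s i < δ := by
    rw [hs, div_lt_iff₀ (by positivity)]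
    nlinarith [(Nat.cast_nonneg i : (0:ℝ) ≤ i)]
  have hsinj (i j) (h : i ≠ j) : s i ≠ s j := by
    intro he
    rw [hs, div_eq_div_iff (by positivity) (by positivity)] at he
    have := mul_left_cancel₀ hδ.ne' he
    exact h (by exact_mod_cast (add_right_cancel this).symm)
  have hall (i j : ℕ) := hball (y := (s i, s j)) (by
    rw [Prod.dist_eq]
    simp [abs_of_pos, hs0, hsδ])
  refine ⟨fun e i => shift (P e) (N e) (s i), ?_, ?_, ?_, ?_, ?_, ?_, ?_⟩
  · intro e i
    obtain ⟨h1, h2⟩ := (hall i i).1.1.1 e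
    exact simpleChain_shift (hP.simple e).two_le h1 h2
  · intro e i
    rw [shift_of_eq_zero (hN e).zero, hP.start]
  · intro e i
    rw [shift_of_eq_zero (hN e).top, hP.finish]
  · intro e i m v hm hv
    exact (hall i i).1.1.2 e m hm v hv
  · intro e i j m n z hij hm hn hz hz'
    rw [← hP.start, ← hP.finish]
    have h2 := (hP.simple e).two_le
    rcases le_total m n with hmn | hmn
    · exact eq_end_of_mem_copies (hN e) h2 (hsinj i j hij) ((hall i j).1.1.1 e).1
        ((hall j i).1.1.1 e).1 ((hall i j).1.1.1 e).2 hn hmn hz hz'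
    · exact eq_end_of_mem_copies (hN e) h2 (hsinj j i hij.symm) ((hall j i).1.1.1 e).1
        ((hall i j).1.1.1 e).1 ((hall j i).1.1.1 e).2 hm hmn hz' hz
  · intro e f i j m n z hef hm hn hz hz'
    exact (hall i j).1.2 ⟨(e, f), hef⟩ m hm n hn z hz hz'
  · intro e f i j n hef hn
    exact (hall i j).2 ⟨(e, f), hef⟩ n hn

end ShiftedCopies

section Halves

variable {ι : Type*} {γ : ι → ℝ → Plane} {T : Set Plane} {k : ι → ℕ} {P : ι → ℕ → Plane}
  {X : ι → ι → ℕ → ℕ → Plane → Prop} {C : ι → ℕ → ℕ → Plane}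

/-- A chain without its first segment. -/
def polyRest (P : ℕ → Plane) (k : ℕ) : Set Plane := polyChain (fun m => P (m + 1)) (k - 1)

lemma mem_polyRest {P : ℕ → Plane} {k : ℕ} {z : Plane} :
    z ∈ polyRest P k ↔ ∃ m < k, 0 < m ∧ z ∈ segment ℝ (P m) (P (m + 1)) := by
  rw [polyRest, mem_polyChain]
  constructor
  · rintro ⟨m, hm, h⟩
    exact ⟨m + 1, by omega, by omega, h⟩
  · rintro ⟨m, hm, hm0, h⟩
    obtain ⟨n, rfl⟩ : ∃ n, m = n + 1 := ⟨m - 1, by omega⟩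
    exact ⟨n, by omega, h⟩

lemma SimpleChain.isArc_polyRest {P : ℕ → Plane} {k : ℕ} (h : SimpleChain k P) :
    IsArc (polyRest P k) (P 1) (P k) := by
  have h2 := h.two_le
  have := isArc_polyChain (P := fun m => P (m + 1)) (k := k - 1) (by omega)
    (fun m hm => (h.succ_ne (by omega)).symm)
    (fun m hm z hz => eq_of_mem_consecutive_segments (h.near (m + 1) (by omega)) hz.1 hz.2)
    (fun m n hmn hn => h.far (m + 1) (n + 1) (by omega) (by omega))
  rwa [show k - 1 + 1 = k by omega] at this

lemma SimpleChain.eq_of_mem_halves {P : ℕ → Plane} {k : ℕ} (h : SimpleChain k P) {z : Plane}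
    (hz : z ∈ segment ℝ (P 0) (P 1)) (hz' : z ∈ polyRest P k) : z = P 1 := by
  obtain ⟨m, hm, hm0, hz'⟩ := mem_polyRest.1 hz'
  rcases (by omega : m = 1 ∨ 2 ≤ m) with rfl | h2
  · exact eq_of_mem_consecutive_segments (h.near 0 (by omega)) hz hz'
  · exact absurd hz' (Set.disjoint_left.1 (h.far 0 m (by omega) hm) hz)

namespace CopySystem

lemma mid_notMem (hC : CopySystem γ T k X C) (e : ι) (i : ℕ) : C e i 1 ∉ T := by
  intro h
  have h2 := (hC.simple e i).two_le
  rcases hC.end_of_mem e i 0 _ (by omega) h (right_mem_segment ..) with ⟨-, h⟩ | ⟨h, -⟩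
  · exact (hC.simple e i).succ_ne (m := 0) (by omega) h
  · omega

lemma mid_mem (hC : CopySystem γ T k X C) (e : ι) (i : ℕ) :
    C e i 1 ∈ polyChain (C e i) (k e) :=
  mem_polyChain.2 ⟨0, by have := (hC.simple e i).two_le; omega, right_mem_segment ..⟩

lemma eq_of_mid_mem (hC : CopySystem γ T k X C) (hT0 : ∀ e, γ e 0 ∈ T) (hT1 : ∀ e, γ e 1 ∈ T)
    {e f : ι} {i j : ℕ} (h : C e i 1 ∈ polyChain (C f j) (k f)) : e = f ∧ i = j := by
  obtain ⟨n, hn, h⟩ := mem_polyChain.1 h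
  by_cases hef : e = f
  · subst hef
    refine ⟨rfl, ?_⟩
    by_contra hij
    have h2 := (hC.simple e i).two_le
    rcases hC.copies e i j 0 n _ hij (by omega) hn (right_mem_segment ..) h with h | h
    · exact hC.mid_notMem e i (h ▸ hT0 e)
    · exact hC.mid_notMem e i (h ▸ hT1 e)
  · exact absurd h (hC.joint e f i j n hef hn)

/-- Copies of distinct arcs cross at most as often as the original arcs. -/
lemma finite_and_ncard_le (hC : CopySystem γ T k X C) (hP : PolySystem γ T k P X)
    (hT0 : ∀ e, γ e 0 ∈ T) (hT1 : ∀ e, γ e 1 ∈ T) {e f : ι} (hef : e ≠ f) (i j : ℕ)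
    (hfin : ((γ e '' Icc 0 1 ∩ γ f '' Icc 0 1) \ T).Finite) :
    ((polyChain (C e i) (k e) ∩ polyChain (C f j) (k f)) \ T).Finite ∧
      ((polyChain (C e i) (k e) ∩ polyChain (C f j) (k f)) \ T).ncard ≤
        ((γ e '' Icc 0 1 ∩ γ f '' Icc 0 1) \ T).ncard := by
  have hex : ∀ z, ∃ p m n, z ∈ (polyChain (C e i) (k e) ∩ polyChain (C f j) (k f)) \ T →
      m < k e ∧ n < k f ∧ z ∈ segment ℝ (C e i m) (C e i (m + 1)) ∧
      z ∈ segment ℝ (C f j n) (C f j (n + 1)) ∧ X e f m n p ∧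
      wedge (C e i (m + 1) - C e i m) (C f j (n + 1) - C f j n) ≠ 0 := by
    intro z
    by_cases hz : z ∈ (polyChain (C e i) (k e) ∩ polyChain (C f j) (k f)) \ T
    · obtain ⟨m, hm, h1⟩ := mem_polyChain.1 hz.1.1
      obtain ⟨n, hn, h2⟩ := mem_polyChain.1 hz.1.2
      rcases hC.cross e f i j m n z hef hm hn h1 h2 with rfl | rfl | ⟨⟨p, hp⟩, hw⟩
      · exact absurd (hT0 e) hz.2
      · exact absurd (hT1 e) hz.2
      · exact ⟨p, m, n, fun _ => ⟨hm, hn, h1, h2, hp, hw⟩⟩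
    · exact ⟨0, 0, 0, fun h => absurd h hz⟩
  choose p m n h using hex
  have hmaps : MapsTo p ((polyChain (C e i) (k e) ∩ polyChain (C f j) (k f)) \ T)
      ((γ e '' Icc 0 1 ∩ γ f '' Icc 0 1) \ T) := by
    intro z hz
    obtain ⟨hm, hn, -, -, hX, -⟩ := h z hz
    obtain ⟨h1, h2, h3, -⟩ := hP.cross_spec e f _ _ _ hef hm hn hX
    exact ⟨⟨h2, h3⟩, h1⟩
  have hinj : InjOn p ((polyChain (C e i) (k e) ∩ polyChain (C f j) (k f)) \ T) := by
    intro z hz z' hz' hpp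
    obtain ⟨hm, hn, h1, h2, hX, hw⟩ := h z hz
    obtain ⟨hm', hn', h1', h2', hX', -⟩ := h z' hz'
    rw [← hpp] at hX'
    obtain ⟨h3, h4⟩ := hP.cross_uniq e f _ _ _ _ _ hef hm hn hm' hn' hX hX'
    rw [← h3] at h1'
    rw [← h4] at h2'
    exact eq_of_mem_segments_of_wedge_ne hw h1 h2 h1' h2'
  exact ⟨Set.Finite.of_injOn hmaps hinj hfin, Set.ncard_le_ncard_of_injOn p hmaps hinj hfin⟩

end CopySystem

end Halves

section Redrawing

variable {V : Type*} {G : SimpleGraph V} {w : Sym2 V → ℕ}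

/-- The arcs of a drawing admit infinitely many copies each, which cross no more than the
original arcs do. -/
lemma Drawing.exists_copies [Finite V] (D : Drawing G) (hD : D.CrossSet.Finite) :
    ∃ (k : G.edgeSet → ℕ) (C : G.edgeSet → ℕ → ℕ → Plane)
      (X : G.edgeSet → G.edgeSet → ℕ → ℕ → Plane → Prop),
      CopySystem D.arc (range D.vert) k X C ∧ ∀ e f, e ≠ f → ∀ i j,
        ((polyChain (C e i) (k e) ∩ polyChain (C f j) (k f)) \ range D.vert).Finite ∧
        ((polyChain (C e i) (k e) ∩ polyChain (C f j) (k f)) \ range D.vert).ncard ≤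
          (D.interOf e ∩ D.interOf f).ncard := by
  choose γ hγ hγD using D.exists_continuous_arc
  have hγ0 (e) : γ e 0 = D.arc e 0 := hγD e (by simp)
  have hγ1 (e) : γ e 1 = D.arc e 1 := hγD e (by simp)
  have himage (e) : γ e '' Icc 0 1 = D.arcSet e := (hγD e).image_eq
  have hinter (e f) : (γ e '' Icc 0 1 ∩ γ f '' Icc 0 1) \ range D.vert =
      D.interOf e ∩ D.interOf f := by
    rw [himage, himage, Drawing.interOf_eq, Drawing.interOf_eq]
    ext z
    simp only [mem_sdiff, mem_inter_iff]
    tauto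
  have h0 (e) : γ e 0 ∈ range D.vert := by
    obtain ⟨x, y, -, hx, -⟩ := D.arc_ends e
    exact ⟨x, by rw [hγ0, hx]⟩
  have h1 (e) : γ e 1 ∈ range D.vert := by
    obtain ⟨x, y, -, -, hy⟩ := D.arc_ends e
    exact ⟨y, by rw [hγ1, hy]⟩
  set S : Set Plane := range D.vert ∪
    ⋃ ef : {ef : G.edgeSet × G.edgeSet // ef.1 ≠ ef.2}, D.interOf ef.1.1 ∩ D.interOf ef.1.2
  have hA : ArcSystem γ S := by
    refine ⟨hγ, fun e => (D.arc_injOn e).congr (hγD e).symm, ?_, fun e => Or.inl (h0 e),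
      fun e => Or.inl (h1 e), ?_⟩
    · exact (finite_range _).union
        (finite_iUnion fun ef => Drawing.finite_inter_of_crossSet_finite hD ef.2)
    · intro e f hef s hs t ht hst
      by_cases hv : γ e s ∈ range D.vert
      · exact Or.inl hv
      · refine Or.inr (mem_iUnion.2 ⟨⟨(e, f), hef⟩, ?_⟩)
        rw [← hinter]
        exact ⟨⟨⟨s, hs, rfl⟩, ⟨t, ht, hst.symm⟩⟩, hv⟩
  have hT (e p) (hp : Meets γ S e p) (hv : p ∈ range D.vert) : p = γ e 0 ∨ p = γ e 1 := by
    obtain ⟨-, t, ht, rfl⟩ := hp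
    obtain ⟨v, hv⟩ := hv
    rw [hγD e ht] at hv
    exact (D.arc_avoid e t ht ⟨v, hv.symm⟩).imp (congrArg _) (congrArg _)
  obtain ⟨k, P, X, hP⟩ := hA.exists_polySystem subset_union_left h0 h1 hT
  obtain ⟨C, hC⟩ := hP.exists_copySystem (finite_range _)
  refine ⟨k, C, X, { hC with
    start := fun e i => (hC.start e i).trans (hγ0 e)
    finish := fun e i => (hC.finish e i).trans (hγ1 e)
    copies := fun e i j m n z => by simpa only [hγ0, hγ1] using hC.copies e i j m n z
    cross := fun e f i j m n z => by simpa only [hγ0, hγ1] using hC.cross e f i j m n z },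
    fun e f hef i j => ?_⟩
  have hle := hC.finite_and_ncard_le hP h0 h1 hef i j
  rw [hinter] at hle
  exact hle (Drawing.finite_inter_of_crossSet_finite hD hef)

/-- From a drawing of a weighted graph, replace each arc by nearby copies of it. -/
lemma exists_drawing_ncard_le [Finite V] (D : Drawing G) (hD : D.CrossSet.Finite) :
    ∃ D' : Drawing (assocGraph G w), D'.CrossSet.Finite ∧ D'.CrossSet.ncard ≤ D.wcount w := by
  classical
  have := Fintype.ofFinite G.edgeSet
  have := Fintype.ofFinite (assocGraph G w).edgeSet
  obtain ⟨k, C, X, hC, hle⟩ := D.exists_copies hD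
  choose x y hxy hx hy using D.arc_ends
  have hT0 (e) : D.arc e 0 ∈ range D.vert := ⟨x e, (hx e).symm⟩
  have hT1 (e) : D.arc e 1 ∈ range D.vert := ⟨y e, (hy e).symm⟩
  have hCx (e i) : C e i 0 = D.vert (x e) := (hC.start e i).trans (hx e)
  have hCy (e i) : C e i (k e) = D.vert (y e) := (hC.finish e i).trans (hy e)
  have h2 (e) : 2 ≤ k e := (hC.simple e 0).two_le
  choose q u hu hq using exists_eq_halfEdge (G := G) (w := w)
  have hux (h) : u h = x (q h).1 ∨ u h = y (q h).1 := by
    have := hu h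
    rwa [hxy, Sym2.mem_iff] at this
  let mid (r : Σ e : G.edgeSet, Fin (w e)) : Plane := C r.1 r.2 1
  let vert' : V ⊕ (Σ e : G.edgeSet, Fin (w e)) → Plane := Sum.elim D.vert mid
  let chain (r : Σ e : G.edgeSet, Fin (w e)) : Set Plane := polyChain (C r.1 r.2) (k r.1)
  let A (h : (assocGraph G w).edgeSet) : Set Plane := if u h = x (q h).1 then
    segment ℝ (C (q h).1 (q h).2 0) (C (q h).1 (q h).2 1) else
      polyRest (C (q h).1 (q h).2) (k (q h).1)
  have hAchain (h) : A h ⊆ chain (q h) := by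
    intro z hz
    simp only [A] at hz
    split_ifs at hz with hux
    · exact mem_polyChain.2 ⟨0, by have := h2 (q h).1; omega, hz⟩
    · obtain ⟨m, hm, -, hz⟩ := mem_polyRest.1 hz
      exact mem_polyChain.2 ⟨m, hm, hz⟩
  have hmid {r r'} (h : mid r ∈ chain r') : r = r' := by
    obtain ⟨e, i⟩ := r
    obtain ⟨f, j⟩ := r'
    obtain ⟨rfl : e = f, h : (i : ℕ) = j⟩ := hC.eq_of_mid_mem hT0 hT1 h
    rw [Fin.ext h]
  have hinj : Function.Injective vert' := by
    rintro (v | r) (v' | r') h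
    · exact congrArg _ (D.vert_inj h)
    · exact absurd ⟨v, h⟩ (hC.mid_notMem r'.1 r'.2)
    · exact absurd ⟨v', h.symm⟩ (hC.mid_notMem r.1 r.2)
    · have h : mid r = mid r' := h
      exact congrArg _ (hmid (h ▸ hC.mid_mem r'.1 r'.2))
  have hrange : range D.vert ⊆ range vert' := by
    rintro _ ⟨v, rfl⟩
    exact ⟨Sum.inl v, rfl⟩
  obtain ⟨D', hDv, hDA⟩ := Drawing.exists_of_isArc (G := assocGraph G w) hinj A (fun h => by
      refine ⟨Sum.inl (u h), Sum.inr (q h), congrArg Subtype.val (hq h), ?_⟩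
      change IsArc _ (D.vert (u h)) (C (q h).1 (q h).2 1)
      simp only [A]
      split_ifs with hxu
      · rw [hxu, ← hCx _ (q h).2]
        exact isArc_segment ((hC.simple _ _).succ_ne (m := 0) (by have := h2 (q h).1; omega)).symm
      · rw [(hux h).resolve_left hxu, ← hCy _ (q h).2]
        exact (hC.simple _ _).isArc_polyRest.symm) (fun h a ha => by
      rw [hq h]
      simp only [halfEdge, Sym2.mem_iff]
      rcases a with v | r
      · left
        congr 1
        apply D.vert_inj
        have ha : D.vert v ∈ A h := ha
        simp only [A] at ha
        have h3 := h2 (q h).1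
        split_ifs at ha with hxu
        · rcases hC.end_of_mem (q h).1 (q h).2 0 _ (by omega) ⟨v, rfl⟩ ha with ⟨-, h4⟩ | ⟨h4, -⟩
          · rw [h4, hCx, hxu]
          · omega
        · obtain ⟨m, hm, hm0, ha⟩ := mem_polyRest.1 ha
          rcases hC.end_of_mem (q h).1 (q h).2 m _ hm ⟨v, rfl⟩ ha with ⟨h4, -⟩ | ⟨-, h4⟩
          · omega
          · rw [h4, hCy, (hux h).resolve_left hxu]
      · right
        rw [hmid (hAchain h ha)])
  have hinter (h z) (hz : z ∈ D'.interOf h) : z ∈ A h ∧ z ∉ range vert' := by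
    rwa [Drawing.interOf_eq, hDv, hDA] at hz
  have hsame (h h' z) (hz : z ∈ D'.interOf h) (hz' : z ∈ D'.interOf h')
      (he : (q h).1 = (q h').1) : h = h' := by
    obtain ⟨hz, hzv⟩ := hinter h z hz
    obtain ⟨hz', -⟩ := hinter h' z hz'
    have hqq : q h = q h' := by
      have hc := hAchain h hz
      have hc' := hAchain h' hz'
      generalize q h = r at *
      generalize q h' = r' at *
      obtain ⟨e, i⟩ := r
      obtain ⟨f, j⟩ := r'
      subst he
      by_contra hij
      obtain ⟨m, hm, h1⟩ := mem_polyChain.1 hc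
      obtain ⟨n, hn, h2⟩ := mem_polyChain.1 hc'
      have hij : (i : ℕ) ≠ j := fun h => hij (by rw [Fin.ext h])
      rcases hC.copies e i j m n z hij hm hn h1 h2 with rfl | rfl
      · exact hzv (hrange (hT0 e))
      · exact hzv (hrange (hT1 e))
    have huu : u h = u h' := by
      simp only [A] at hz hz'
      rw [← hqq] at hz'
      split_ifs at hz hz' with h3 h4 h4
      · rw [h3, h4]
      · exact absurd ⟨Sum.inr (q h), ((hC.simple _ _).eq_of_mem_halves hz hz').symm⟩ hzv
      · exact absurd ⟨Sum.inr (q h), ((hC.simple _ _).eq_of_mem_halves hz' hz).symm⟩ hzv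
      · have h5 := hux h'
        rw [← hqq] at h5
        rw [(hux h).resolve_left h3, h5.resolve_left h4]
    rw [hq h, hq h']
    apply Subtype.ext
    simp only [halfEdge, huu, hqq]
  let B (r r' : Σ e : G.edgeSet, Fin (w e)) : Set Plane :=
    if r.1 = r'.1 then ∅ else (chain r ∩ chain r') \ range D.vert
  have hBfin (r r') : (B r r').Finite := by
    simp only [B]
    split_ifs with h
    · exact finite_empty
    · exact (hle _ _ h _ _).1
  let T := {t : Plane × (assocGraph G w).edgeSet × (assocGraph G w).edgeSet |
    t.2.1 ≠ t.2.2 ∧ t.1 ∈ D'.interOf t.2.1 ∩ D'.interOf t.2.2}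
  let TQ := {t : Plane × (Σ e : G.edgeSet, Fin (w e)) × (Σ e : G.edgeSet, Fin (w e)) |
    t.1 ∈ B t.2.1 t.2.2}
  let F (t : Plane × (assocGraph G w).edgeSet × (assocGraph G w).edgeSet) :=
    (t.1, q t.2.1, q t.2.2)
  have hmaps : MapsTo F T TQ := by
    rintro ⟨z, h, h'⟩ ⟨hhh, hz, hz'⟩
    have : (q h).1 ≠ (q h').1 := fun he => hhh (hsame h h' z hz hz' he)
    simp only [TQ, F, B, mem_ofPred_eq, this, if_false]
    exact ⟨⟨hAchain h (hinter h z hz).1, hAchain h' (hinter h' z hz').1⟩,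
      fun h1 => (hinter h z hz).2 (hrange h1)⟩
  have hFinj : InjOn F T := by
    rintro ⟨z, h, h'⟩ ⟨-, hz, hz'⟩ ⟨z₂, g, g'⟩ ⟨-, hw, hw'⟩ he
    simp only [F, Prod.mk.injEq] at he
    obtain ⟨rfl, he, he'⟩ := he
    rw [hsame h g z hz hw (congrArg _ he), hsame h' g' z hz' hw' (congrArg _ he')]
  have hTQfin : TQ.Finite := finite_setOf_triples hBfin
  have hTfin : T.Finite := Set.Finite.of_injOn hmaps hFinj hTQfin
  have hD' : D'.CrossSet.Finite := Drawing.crossSet_finite fun h h' hhh =>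
    (hTfin.image Prod.fst).subset fun z hz => ⟨(z, h, h'), ⟨hhh, hz⟩, rfl⟩
  refine ⟨D', hD', ?_⟩
  have : 2 * D'.CrossSet.ncard ≤ 2 * D.wcount w := by
    rw [Drawing.two_mul_ncard_crossSet hD', Drawing.two_mul_wcount hD]
    calc T.ncard ≤ TQ.ncard := Set.ncard_le_ncard_of_injOn F hmaps hFinj hTQfin
      _ = ∑ r, ∑ r', (B r r').ncard := ncard_setOf_triples hBfin
      _ ≤ ∑ r : (Σ e : G.edgeSet, Fin (w e)), ∑ r' : (Σ e : G.edgeSet, Fin (w e)),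
          if r.1 = r'.1 then 0 else (D.interOf r.1 ∩ D.interOf r'.1).ncard := by
        refine Finset.sum_le_sum fun r _ => Finset.sum_le_sum fun r' _ => ?_
        simp only [B]
        split_ifs with h
        · simp
        · exact (hle _ _ h _ _).2
      _ = _ := by
        rw [Fintype.sum_sigma]
        refine Finset.sum_congr rfl fun e _ => ?_
        simp_rw [Fintype.sum_sigma]
        simp only [Finset.sum_const, Finset.card_univ, Fintype.card_fin, smul_eq_mul,
          Finset.mul_sum]
        refine Finset.sum_congr rfl fun f _ => ?_
        split_ifs
        · simp
        · ring
  omega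

lemma Nat.sInf_le_sInf_of_forall_exists_le {s t : Set ℕ} (hts : t.Nonempty → s.Nonempty)
    (h : ∀ a ∈ s, ∃ b ∈ t, b ≤ a) : sInf t ≤ sInf s := by
  rcases s.eq_empty_or_nonempty with rfl | hs
  · rcases t.eq_empty_or_nonempty with rfl | ht
    · exact le_rfl
    · exact absurd (hts ht) (by simp)
  · obtain ⟨b, hb, hle⟩ := h _ (Nat.sInf_mem hs)
    exact (Nat.sInf_le hb).trans hle

end Redrawing

/-- Theorem. Let `(G, w)` be a simple weighted graph (with positive integer edge
weights) and let `G'` be its associated simple graph.  Then `cr (G, w) = cr G'`. -/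
theorem wcrNum_eq_crNum_assocGraph {V : Type*} [Fintype V] (G : SimpleGraph V)
    (w : Sym2 V → ℕ) (hw : ∀ e ∈ G.edgeSet, 0 < w e) :
    wcrNum G w = crNum (assocGraph G w) := by
  have h1 : ∀ a ∈ {n | ∃ D : Drawing G, True ∧ D.CrossSet.Finite ∧ D.wcount w = n},
      ∃ b ∈ {n | ∃ D : Drawing (assocGraph G w), True ∧ D.CrossSet.Finite ∧ D.CrossSet.ncard = n},
        b ≤ a := by
    rintro _ ⟨D, -, hD, rfl⟩
    obtain ⟨D', hD', hle⟩ := exists_drawing_ncard_le (w := w) D hD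
    exact ⟨_, ⟨D', trivial, hD', rfl⟩, hle⟩
  have h2 : ∀ a ∈ {n | ∃ D : Drawing (assocGraph G w), True ∧ D.CrossSet.Finite ∧
      D.CrossSet.ncard = n},
      ∃ b ∈ {n | ∃ D : Drawing G, True ∧ D.CrossSet.Finite ∧ D.wcount w = n}, b ≤ a := by
    rintro _ ⟨D', -, hD', rfl⟩
    obtain ⟨D, hD, hle⟩ := exists_drawing_wcount_le hw D' hD'
    exact ⟨_, ⟨D, trivial, hD, rfl⟩, hle⟩
  refine le_antisymm (Nat.sInf_le_sInf_of_forall_exists_le ?_ h2)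
    (Nat.sInf_le_sInf_of_forall_exists_le ?_ h1)
  · rintro ⟨a, ha⟩
    obtain ⟨b, hb, -⟩ := h1 a ha
    exact ⟨b, hb⟩
  · rintro ⟨a, ha⟩
    obtain ⟨b, hb, -⟩ := h2 a ha
    exact ⟨b, hb⟩

end
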